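/- arXiv:2506.09844 — 3 statements merged into one kernel-verified Lean document; each statement's English description precedes it below -/
import Mathlib

section
/- Let (G,K,H,E) be a trifactorised group (K ⊴ G, G = KE = KH = HE, K ∩ E = H ∩ E = 1), and let L₁, L₂ ≤ K with E_i = L_iH ∩ E satisfying: E = E₁E₂ and K = L₁L₂; [E,L₁] ≤ L₁ and [E₁,K] ≤ L₁; T_i = L_iH ∩ L_iE is an abelian subgroup of G for i = 1,2; and K'H ∩ E ≤ E'([E,K]H ∩ E). Then K'[E,K] is abelian and [K'[E,K]H ∩ E, K'[E,K]] = 1. -/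
open Pointwise
open scoped commutatorElement

/-- In a product `AB = BA` of abelian subgroups, conjugating `⁅a, b⁆` by `b₁` only moves `a`. -/
theorem conj_commutator_right {G : Type*} [Group G] {B : Subgroup G}
    (hB : ∀ x ∈ B, ∀ y ∈ B, x * y = y * x) {a a' b b' b₁ : G} (hb : b ∈ B) (hb' : b' ∈ B)
    (hb₁ : b₁ ∈ B) (h : b₁ * a = a' * b') : b₁ * ⁅a, b⁆ * b₁⁻¹ = ⁅a', b⁆ := by
  have h₁ : b⁻¹ * b₁⁻¹ = b₁⁻¹ * b⁻¹ := hB _ (inv_mem hb) _ (inv_mem hb₁)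
  have h₂ : b' * b = b * b' := hB _ hb' _ hb
  calc b₁ * ⁅a, b⁆ * b₁⁻¹ = b₁ * a * b * a⁻¹ * (b⁻¹ * b₁⁻¹) := by
        simp only [commutatorElement_def]; group
    _ = (b₁ * a) * b * (b₁ * a)⁻¹ * b⁻¹ := by rw [h₁]; group
    _ = a' * (b' * b) * b'⁻¹ * a'⁻¹ * b⁻¹ := by rw [h]; group
    _ = ⁅a', b⁆ := by rw [h₂]; simp only [commutatorElement_def]; group

/-- In a product `AB = BA` of abelian subgroups, conjugating `⁅a, b⁆` by `a₁` only moves `b`. -/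
theorem conj_commutator_left {G : Type*} [Group G] {A : Subgroup G}
    (hA : ∀ x ∈ A, ∀ y ∈ A, x * y = y * x) {a a' a₁ b b' : G} (ha : a ∈ A) (ha' : a' ∈ A)
    (ha₁ : a₁ ∈ A) (h : a₁ * b = b' * a') : a₁ * ⁅a, b⁆ * a₁⁻¹ = ⁅a, b'⁆ := by
  have := conj_commutator_right hA ha ha' ha₁ h
  rw [← commutatorElement_inv b a, ← commutatorElement_inv b' a, ← this]
  group

/-- Two subgroups whose setwise product is a subgroup permute. -/
theorem exists_mul_eq_mul_swap {G : Type*} [Group G] {A B K : Subgroup G}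
    (hK : (A : Set G) * (B : Set G) = (K : Set G)) {a b : G} (ha : a ∈ A) (hb : b ∈ B) :
    ∃ a' ∈ A, ∃ b' ∈ B, b * a = a' * b' := by
  have h : a⁻¹ * b⁻¹ ∈ (A : Set G) * (B : Set G) :=
    Set.mul_mem_mul (inv_mem ha) (inv_mem hb)
  rw [hK] at h
  have h' : b * a ∈ (K : Set G) := by simpa using K.inv_mem h
  rw [← hK] at h'
  obtain ⟨a', ha', b', hb', e⟩ := h'
  exact ⟨a', ha', b', hb', e.symm⟩

/-- If a group is a product of abelian subgroups `A` and `B`, its derived subgroup is generated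
by the commutators `⁅a, b⁆` with `a ∈ A` and `b ∈ B`. -/
theorem commutator_le_commutator_of_mul_eq {G : Type*} [Group G] {A B K : Subgroup G}
    (hA : ∀ x ∈ A, ∀ y ∈ A, x * y = y * x) (hB : ∀ x ∈ B, ∀ y ∈ B, x * y = y * x)
    (hK : (A : Set G) * (B : Set G) = (K : Set G)) : ⁅K, K⁆ ≤ ⁅A, B⁆ := by
  rw [Subgroup.commutator_le]
  intro x hx y hy
  have hx' : x ∈ (A : Set G) * (B : Set G) := hK ▸ hx
  have hy' : y⁻¹ ∈ (A : Set G) * (B : Set G) := hK ▸ K.inv_mem hy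
  obtain ⟨a, ha, b, hb, rfl⟩ := hx'
  obtain ⟨c, hc, d, hd, hcd⟩ := hy'
  obtain rfl : y = d⁻¹ * c⁻¹ := by
    rw [← mul_inv_rev]
    exact eq_inv_of_mul_eq_one_right (by rw [show c * d = y⁻¹ from hcd, inv_mul_cancel])
  obtain ⟨a₂, ha₂, b₂, hb₂, h₂⟩ := exists_mul_eq_mul_swap hK (inv_mem hc) (inv_mem hd)
  obtain ⟨a₃, ha₃, b₃, hb₃, h₃⟩ := exists_mul_eq_mul_swap hK (inv_mem ha) (inv_mem hb)
  have h₃' : a * b = b₃⁻¹ * a₃⁻¹ := by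
    rw [← mul_inv_rev, ← h₃]; group
  have key : a * (d⁻¹ * ⁅c⁻¹, b⁆ * d⁻¹⁻¹) * a⁻¹ = ⁅a₂, b₃⁻¹⁆ := by
    rw [conj_commutator_right hB hb hb₂ (inv_mem hd) h₂,
      conj_commutator_left hA ha₂ (inv_mem ha₃) ha h₃']
  have hbd : b * d⁻¹ = d⁻¹ * b := hB _ hb _ (inv_mem hd)
  have hac : a⁻¹ * c = c * a⁻¹ := hA _ (inv_mem ha) _ hc
  have : ⁅a * b, d⁻¹ * c⁻¹⁆ = ⁅a₂, b₃⁻¹⁆⁻¹ * ⁅a, d⁻¹⁆ := by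
    rw [← key]
    calc ⁅a * b, d⁻¹ * c⁻¹⁆ = a * (b * d⁻¹) * c⁻¹ * b⁻¹ * (a⁻¹ * c) * d := by
          simp only [commutatorElement_def]; group
      _ = a * d⁻¹ * b * c⁻¹ * b⁻¹ * (c * a⁻¹) * d := by
          rw [hbd, hac]; group
      _ = _ := by simp only [commutatorElement_def]; group
  rw [this]
  exact mul_mem (inv_mem (Subgroup.commutator_mem_commutator ha₂ (inv_mem hb₃)))
    (Subgroup.commutator_mem_commutator ha (inv_mem hd))

/-- If `x * y` and `y * x` conjugate `z` in the same way, then `z` commutes with `⁅x⁻¹, y⁻¹⁆`. -/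
theorem mul_commutator_inv_eq_of_conj_eq {G : Type*} [Group G] {x y z : G}
    (h : x * y * z * (x * y)⁻¹ = y * x * z * (y * x)⁻¹) :
    z * ⁅x⁻¹, y⁻¹⁆ = ⁅x⁻¹, y⁻¹⁆ * z := by
  calc z * ⁅x⁻¹, y⁻¹⁆ = (y * x)⁻¹ * (y * x * z * (y * x)⁻¹) * (x * y) := by
        simp only [commutatorElement_def]; group
    _ = ⁅x⁻¹, y⁻¹⁆ * z := by rw [← h]; simp only [commutatorElement_def]; group

/-- **Itô's theorem**: a product of two abelian subgroups is metabelian. -/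
theorem commutator_commute_of_mul_eq {G : Type*} [Group G] {A B K : Subgroup G}
    (hA : ∀ x ∈ A, ∀ y ∈ A, x * y = y * x) (hB : ∀ x ∈ B, ∀ y ∈ B, x * y = y * x)
    (hK : (A : Set G) * (B : Set G) = (K : Set G)) :
    ⁅K, K⁆ ≤ Subgroup.centralizer (⁅K, K⁆ : Subgroup G) := by
  have hle := commutator_le_commutator_of_mul_eq hA hB hK
  have hcomm : ⁅A, B⁆ ≤ Subgroup.centralizer (⁅A, B⁆ : Subgroup G) := by
    rw [Subgroup.commutator_le]
    intro a₁ ha₁ b₁ hb₁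
    rw [← inv_inv a₁, ← inv_inv b₁]
    replace ha₁ := inv_mem ha₁
    replace hb₁ := inv_mem hb₁
    generalize a₁⁻¹ = a₁ at *
    generalize b₁⁻¹ = b₁ at *
    suffices hle' : ⁅A, B⁆ ≤ Subgroup.centralizer {⁅a₁⁻¹, b₁⁻¹⁆} from
      Subgroup.mem_centralizer_iff.mpr fun h hh =>
        Subgroup.mem_centralizer_singleton_iff.mp (hle' hh)
    rw [Subgroup.commutator_le]
    intro a ha b hb
    obtain ⟨a₂, ha₂, b₂, hb₂, h₂⟩ := exists_mul_eq_mul_swap hK ha hb₁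
    obtain ⟨a₃, ha₃, b₃, hb₃, h₃⟩ := exists_mul_eq_mul_swap hK (inv_mem ha₁) (inv_mem hb)
    have h₃' : a₁ * b = b₃⁻¹ * a₃⁻¹ := by
      rw [← mul_inv_rev, ← h₃]; group
    have e₁ : a₁ * (b₁ * ⁅a, b⁆ * b₁⁻¹) * a₁⁻¹ = ⁅a₂, b₃⁻¹⁆ := by
      rw [conj_commutator_right hB hb hb₂ hb₁ h₂,
        conj_commutator_left hA ha₂ (inv_mem ha₃) ha₁ h₃']
    have e₂ : b₁ * (a₁ * ⁅a, b⁆ * a₁⁻¹) * b₁⁻¹ = ⁅a₂, b₃⁻¹⁆ := by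
      rw [conj_commutator_left hA ha (inv_mem ha₃) ha₁ h₃',
        conj_commutator_right hB (inv_mem hb₃) hb₂ hb₁ h₂]
    rw [Subgroup.mem_centralizer_singleton_iff]
    refine mul_commutator_inv_eq_of_conj_eq ?_
    calc _ = a₁ * (b₁ * ⁅a, b⁆ * b₁⁻¹) * a₁⁻¹ := by group
      _ = b₁ * (a₁ * ⁅a, b⁆ * a₁⁻¹) * b₁⁻¹ := by rw [e₁, e₂]
      _ = _ := by group
  exact hle.trans (hcomm.trans (Subgroup.centralizer_le hle))

/-- A subgroup `K` normalises `⁅E, K⁆`. -/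
theorem conj_mem_commutator_right {G : Type*} [Group G] {E K : Subgroup G} {k n : G}
    (hk : k ∈ K) (hn : n ∈ ⁅E, K⁆) : k * n * k⁻¹ ∈ ⁅E, K⁆ := by
  suffices h : ⁅E, K⁆ ≤ ⁅E, K⁆.comap (MulAut.conj k).toMonoidHom from h hn
  rw [Subgroup.commutator_le]
  intro e he l hl
  have : k * ⁅e, l⁆ * k⁻¹ = ⁅e, k⁆⁻¹ * ⁅e, k * l⁆ := by
    simp only [commutatorElement_def]; group
  change k * ⁅e, l⁆ * k⁻¹ ∈ ⁅E, K⁆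
  rw [this]
  exact mul_mem (inv_mem (Subgroup.commutator_mem_commutator he hk))
    (Subgroup.commutator_mem_commutator he (mul_mem hk hl))

/-- Theorem on trifactorised groups: under the hypotheses below, `K'[E,K]` is
abelian and `[K'[E,K]H ∩ E, K'[E,K]] = 1`. -/
theorem trifactorised_ito {G : Type*} [Group G]
    (K H E : Subgroup G) [K.Normal]
    (hKE : (K : Set G) * (E : Set G) = Set.univ)
    (hKH : (K : Set G) * (H : Set G) = Set.univ)
    (hHE : (H : Set G) * (E : Set G) = Set.univ)
    (hKEt : K ⊓ E = ⊥) (hHEt : H ⊓ E = ⊥)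
    (L₁ L₂ : Subgroup G) (hL₁ : L₁ ≤ K) (hL₂ : L₂ ≤ K)
    -- `E = E₁E₂` and `K = L₁L₂`, where `Eᵢ = LᵢH ∩ E`
    (hE : (((L₁ : Set G) * (H : Set G)) ∩ (E : Set G)) *
        (((L₂ : Set G) * (H : Set G)) ∩ (E : Set G)) = (E : Set G))
    (hK : (L₁ : Set G) * (L₂ : Set G) = (K : Set G))
    -- `[E,L₁] ≤ L₁` and `[E₁,K] ≤ L₁`
    (hEL₁ : ∀ e ∈ E, ∀ l ∈ L₁, e * l * e⁻¹ * l⁻¹ ∈ L₁)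
    (hE₁K : ∀ e ∈ ((L₁ : Set G) * (H : Set G)) ∩ (E : Set G),
      ∀ k ∈ K, e * k * e⁻¹ * k⁻¹ ∈ L₁)
    -- `Tᵢ = LᵢH ∩ LᵢE` is an abelian subgroup of `G`
    (hT₁ : ∃ T₁ : Subgroup G,
      (T₁ : Set G) = ((L₁ : Set G) * (H : Set G)) ∩ ((L₁ : Set G) * (E : Set G)) ∧
      ∀ a ∈ T₁, ∀ b ∈ T₁, a * b = b * a)
    (hT₂ : ∃ T₂ : Subgroup G,
      (T₂ : Set G) = ((L₂ : Set G) * (H : Set G)) ∩ ((L₂ : Set G) * (E : Set G)) ∧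
      ∀ a ∈ T₂, ∀ b ∈ T₂, a * b = b * a)
    -- `K'H ∩ E ≤ E'([E,K]H ∩ E)`
    (hincl : (((⁅K, K⁆ : Subgroup G) : Set G) * (H : Set G)) ∩ (E : Set G) ⊆
      ((⁅E, E⁆ : Subgroup G) : Set G) * ((((⁅E, K⁆ : Subgroup G) : Set G) * (H : Set G)) ∩ (E : Set G))) :
    (∀ a ∈ ((⁅K, K⁆ : Subgroup G) : Set G) * ((⁅E, K⁆ : Subgroup G) : Set G),
      ∀ b ∈ ((⁅K, K⁆ : Subgroup G) : Set G) * ((⁅E, K⁆ : Subgroup G) : Set G), a * b = b * a) ∧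
    (∀ x ∈ (((⁅K, K⁆ : Subgroup G) : Set G) * ((⁅E, K⁆ : Subgroup G) : Set G) * (H : Set G)) ∩ (E : Set G),
      ∀ y ∈ ((⁅K, K⁆ : Subgroup G) : Set G) * ((⁅E, K⁆ : Subgroup G) : Set G), x * y = y * x) := by
  obtain ⟨T₁, hT₁, hT₁c⟩ := hT₁
  obtain ⟨T₂, hT₂, hT₂c⟩ := hT₂
  have mem_T₁ : ∀ l ∈ L₁, l ∈ T₁ := fun l hl => by
    rw [← SetLike.mem_coe, hT₁]
    exact ⟨⟨l, hl, 1, one_mem H, mul_one l⟩, ⟨l, hl, 1, one_mem E, mul_one l⟩⟩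
  have mem_T₂ : ∀ l ∈ L₂, l ∈ T₂ := fun l hl => by
    rw [← SetLike.mem_coe, hT₂]
    exact ⟨⟨l, hl, 1, one_mem H, mul_one l⟩, ⟨l, hl, 1, one_mem E, mul_one l⟩⟩
  have mem_T₁' : ∀ e ∈ ((L₁ : Set G) * (H : Set G)) ∩ (E : Set G), e ∈ T₁ := fun e he => by
    rw [← SetLike.mem_coe, hT₁]
    exact ⟨he.1, ⟨1, one_mem L₁, e, he.2, one_mul e⟩⟩
  have mem_T₂' : ∀ e ∈ ((L₂ : Set G) * (H : Set G)) ∩ (E : Set G), e ∈ T₂ := fun e he => by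
    rw [← SetLike.mem_coe, hT₂]
    exact ⟨he.1, ⟨1, one_mem L₂, e, he.2, one_mul e⟩⟩
  have hA : ∀ x ∈ L₁, ∀ y ∈ L₁, x * y = y * x :=
    fun x hx y hy => hT₁c x (mem_T₁ x hx) y (mem_T₁ y hy)
  have hB : ∀ x ∈ L₂, ∀ y ∈ L₂, x * y = y * x :=
    fun x hx y hy => hT₂c x (mem_T₂ x hx) y (mem_T₂ y hy)
  have hgen := commutator_le_commutator_of_mul_eq hA hB hK
  have conj_L₁ : ∀ e ∈ E, ∀ l ∈ L₁, e * l * e⁻¹ ∈ L₁ := fun e he l hl => by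
    simpa using mul_mem (hEL₁ e he l hl) hl
  have hN : ⁅E, K⁆ ≤ L₁ := by
    rw [Subgroup.commutator_le]
    intro e he k hk
    have he' : e ∈ (((L₁ : Set G) * (H : Set G)) ∩ (E : Set G)) *
        (((L₂ : Set G) * (H : Set G)) ∩ (E : Set G)) := by rwa [hE]
    obtain ⟨e₁, he₁, e₂, he₂, rfl⟩ := he'
    have hk' : k ∈ (L₁ : Set G) * (L₂ : Set G) := hK ▸ hk
    obtain ⟨l₁, hl₁, l₂, hl₂, rfl⟩ := hk'
    have hc : e₂ * l₂ = l₂ * e₂ := hT₂c _ (mem_T₂' e₂ he₂) _ (mem_T₂ l₂ hl₂)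
    have h₂ : ⁅e₂, l₁ * l₂⁆ ∈ L₁ := by
      have : ⁅e₂, l₁ * l₂⁆ = e₂ * l₁ * e₂⁻¹ * l₁⁻¹ := by
        calc ⁅e₂, l₁ * l₂⁆ = e₂ * l₁ * e₂⁻¹ * (e₂ * l₂) * e₂⁻¹ * l₂⁻¹ * l₁⁻¹ := by
              simp only [commutatorElement_def]; group
          _ = _ := by rw [hc]; group
      rw [this]
      exact hEL₁ e₂ he₂.2 l₁ hl₁
    have : ⁅e₁ * e₂, l₁ * l₂⁆ =
        e₁ * ⁅e₂, l₁ * l₂⁆ * e₁⁻¹ * (e₁ * (l₁ * l₂) * e₁⁻¹ * (l₁ * l₂)⁻¹) := by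
      simp only [commutatorElement_def]; group
    change ⁅e₁ * e₂, l₁ * l₂⁆ ∈ L₁
    rw [this]
    exact mul_mem (conj_L₁ e₁ he₁.2 _ h₂) (hE₁K e₁ he₁ _ hk)
  have hK'N : ∀ x ∈ ⁅K, K⁆, ∀ n ∈ ⁅E, K⁆, x * n = n * x := by
    intro x hx n hn
    suffices h : ⁅L₁, L₂⁆ ≤ Subgroup.centralizer (⁅E, K⁆ : Subgroup G) from
      (Subgroup.mem_centralizer_iff.mp (h (hgen hx)) n hn).symm
    rw [Subgroup.commutator_le]
    intro a ha b hb
    rw [Subgroup.mem_centralizer_iff]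
    intro n hn
    have h₁ : b⁻¹ * n * b ∈ L₁ := by
      simpa using hN (conj_mem_commutator_right (inv_mem (hL₂ hb)) hn)
    have h₂ := hA _ (inv_mem ha) _ h₁
    have h₃ := hA a ha n (hN hn)
    have h₄ := hA a ha _ h₁
    calc n * ⁅a, b⁆ = (n * a) * b * a⁻¹ * b⁻¹ := by
          simp only [commutatorElement_def]; group
      _ = a * b * ((b⁻¹ * n * b) * a⁻¹) * b⁻¹ := by rw [← h₃]; group
      _ = ⁅a, b⁆ * n := by rw [← h₂]; simp only [commutatorElement_def]; group
  have hK'K' : ∀ x ∈ ⁅K, K⁆, ∀ y ∈ ⁅K, K⁆, x * y = y * x := fun x hx y hy =>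
    (Subgroup.mem_centralizer_iff.mp (commutator_commute_of_mul_eq hA hB hK hx) y hy).symm
  have hcent : ∀ e ∈ E, (∀ l ∈ L₁, e * l = l * e) →
      ∀ y ∈ ((⁅K, K⁆ : Subgroup G) : Set G) * ((⁅E, K⁆ : Subgroup G) : Set G), e * y = y * e := by
    rintro e he hel _ ⟨x, hx, n, hn, rfl⟩
    have hex : e * x = x * e := by
      suffices h : ⁅L₁, L₂⁆ ≤ Subgroup.centralizer {e} from
        (Subgroup.mem_centralizer_singleton_iff.mp (h (hgen hx))).symm
      rw [Subgroup.commutator_le]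
      intro a ha b hb
      rw [Subgroup.mem_centralizer_singleton_iff]
      have hm : ⁅e, b⁆ ∈ ⁅E, K⁆ := Subgroup.commutator_mem_commutator he (hL₂ hb)
      have h₁ := hK'N _ (Subgroup.commutator_mem_commutator (hL₁ ha) (hL₂ hb)) _ hm
      have h₂ := hA a ha _ (hN hm)
      have h₃ : e * a⁻¹ = a⁻¹ * e := hel _ (inv_mem ha)
      symm
      calc e * ⁅a, b⁆ = (e * a) * b * a⁻¹ * b⁻¹ := by
            simp only [commutatorElement_def]; group
        _ = a * ⁅e, b⁆ * b * (e * a⁻¹) * b⁻¹ := by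
            rw [hel a ha]; simp only [commutatorElement_def]; group
        _ = (a * ⁅e, b⁆) * b * a⁻¹ * (b⁻¹ * ⁅e, b⁆⁻¹ * e) := by
            rw [h₃]; simp only [commutatorElement_def]; group
        _ = (⁅e, b⁆ * ⁅a, b⁆) * ⁅e, b⁆⁻¹ * e := by
            rw [h₂, commutatorElement_def a]; group
        _ = ⁅a, b⁆ * e := by rw [← h₁]; group
    have hen := hel n (hN hn)
    change e * (x * n) = x * n * e
    rw [← mul_assoc, hex, mul_assoc, hen, mul_assoc]
  have hE₁c : ∀ e ∈ ((L₁ : Set G) * (H : Set G)) ∩ (E : Set G), ∀ l ∈ L₁, e * l = l * e :=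
    fun e he l hl => hT₁c _ (mem_T₁' e he) _ (mem_T₁ l hl)
  have hE'c : ⁅E, E⁆ ≤ Subgroup.centralizer (L₁ : Set G) := by
    rw [Subgroup.commutator_le]
    rintro e he f hf
    rw [← inv_inv e, ← inv_inv f]
    replace he := inv_mem he
    replace hf := inv_mem hf
    generalize e⁻¹ = e at *
    generalize f⁻¹ = f at *
    have he' : e ∈ (((L₁ : Set G) * (H : Set G)) ∩ (E : Set G)) *
        (((L₂ : Set G) * (H : Set G)) ∩ (E : Set G)) := by rwa [hE]
    have hf' : f ∈ (((L₁ : Set G) * (H : Set G)) ∩ (E : Set G)) *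
        (((L₂ : Set G) * (H : Set G)) ∩ (E : Set G)) := by rwa [hE]
    obtain ⟨e₁, he₁, e₂, he₂, rfl⟩ := he'
    obtain ⟨f₁, hf₁, f₂, hf₂, rfl⟩ := hf'
    have h₂ : e₂ * f₂ = f₂ * e₂ := hT₂c _ (mem_T₂' e₂ he₂) _ (mem_T₂' f₂ hf₂)
    have act : ∀ g ∈ ((L₁ : Set G) * (H : Set G)) ∩ (E : Set G), ∀ l ∈ L₁, g * l * g⁻¹ = l :=
      fun g hg l hl => mul_inv_eq_of_eq_mul (hE₁c g hg l hl)
    have hconj : ∀ l ∈ L₁, (e₁ * e₂) * (f₁ * f₂) * l * ((e₁ * e₂) * (f₁ * f₂))⁻¹ =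
        (f₁ * f₂) * (e₁ * e₂) * l * ((f₁ * f₂) * (e₁ * e₂))⁻¹ := by
      intro l hl
      have hel := conj_L₁ _ he₂.2 l hl
      have hfl := conj_L₁ _ hf₂.2 l hl
      calc _ = e₁ * (e₂ * (f₁ * (f₂ * l * f₂⁻¹) * f₁⁻¹) * e₂⁻¹) * e₁⁻¹ := by group
        _ = (e₂ * f₂) * l * (e₂ * f₂)⁻¹ := by
          rw [act f₁ hf₁ _ hfl, act e₁ he₁ _ (conj_L₁ _ he₂.2 _ hfl)]; group
        _ = (f₂ * e₂) * l * (f₂ * e₂)⁻¹ := by rw [h₂]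
        _ = f₁ * (f₂ * (e₁ * (e₂ * l * e₂⁻¹) * e₁⁻¹) * f₂⁻¹) * f₁⁻¹ := by
          rw [act e₁ he₁ _ hel, act f₁ hf₁ _ (conj_L₁ _ hf₂.2 _ hel)]; group
        _ = _ := by group
    refine Subgroup.mem_centralizer_iff.mpr fun l hl => ?_
    exact mul_commutator_inv_eq_of_conj_eq (hconj l hl)
  refine ⟨?_, ?_⟩
  · rintro _ ⟨x, hx, n, hn, rfl⟩ _ ⟨y, hy, m, hm, rfl⟩
    change x * n * (y * m) = y * m * (x * n)
    have h₁ := hK'N y hy n hn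
    have h₂ := hK'N x hx m hm
    have h₃ := hK'K' x hx y hy
    have h₄ := hA n (hN hn) m (hN hm)
    calc x * n * (y * m) = x * (n * y) * m := by group
      _ = (x * y) * (n * m) := by rw [← h₁]; group
      _ = y * (x * m) * n := by rw [h₃, h₄]; group
      _ = y * m * (x * n) := by rw [h₂]; group
  · rintro x ⟨⟨_, ⟨k, hk, n, hn, rfl⟩, h, hh, hx⟩, hxE⟩ y hy
    have hx' : k * n * h = x := hx
    have hn' : n⁻¹ ∈ (H : Set G) * (E : Set G) := hHE ▸ Set.mem_univ _
    obtain ⟨h', hh', e', he', hne⟩ := hn'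
    have hne' : h' * e' = n⁻¹ := hne
    have hu : e'⁻¹ = n * h' := by
      rw [eq_comm, ← inv_inj, mul_inv_rev, ← hne']; group
    have hu₁ : e'⁻¹ ∈ ((L₁ : Set G) * (H : Set G)) ∩ (E : Set G) :=
      ⟨⟨n, hN hn, h', hh', hu.symm⟩, inv_mem he'⟩
    have hv : e' * x ∈ (((⁅K, K⁆ : Subgroup G) : Set G) * (H : Set G)) ∩ (E : Set G) := by
      refine ⟨⟨h'⁻¹ * k * h'⁻¹⁻¹, Subgroup.Normal.conj_mem inferInstance k hk h'⁻¹,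
        h'⁻¹ * h, mul_mem (inv_mem hh') hh, ?_⟩, mul_mem he' hxE⟩
      have : e' = h'⁻¹ * n⁻¹ := by rw [← hne']; group
      change h'⁻¹ * k * h'⁻¹⁻¹ * (h'⁻¹ * h) = e' * x
      rw [this, ← hx', hK'N k hk n hn]; group
    obtain ⟨c, hc, w, ⟨⟨m, hm, g, hg, hw⟩, hwE⟩, hcw⟩ := hincl hv
    have hw₁ : w ∈ ((L₁ : Set G) * (H : Set G)) ∩ (E : Set G) := ⟨⟨m, hN hm, g, hg, hw⟩, hwE⟩
    have hcw' : c * w = e' * x := hcw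
    have hxeq : x = e'⁻¹ * (c * w) := by rw [hcw']; group
    refine hcent x hxE (fun l hl => ?_) y hy
    have h₁ : Commute e'⁻¹ l := hE₁c _ hu₁ l hl
    have h₂ : Commute w l := hE₁c _ hw₁ l hl
    have h₃ : Commute c l := (Subgroup.mem_centralizer_iff.mp (hE'c hc) l hl).symm
    rw [hxeq]
    exact h₁.mul_left (h₃.mul_left h₂)
end

section
/- Let (G,K,H,E) be a finite non-trivial trifactorised group, L₁, L₂ ≤ K and E_i = L_iH ∩ E, such that E = E₁E₂, K = L₁L₂, the subgroups L_iH ∩ L_iE are abelian for i = 1,2, and [E,L₁] ≤ L₁. Then there exists a non-trivial normal subgroup of G contained in L₁ or in L₂. -/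
open Pointwise

/-- Every element of a finite monoid has an idempotent positive power. -/
theorem exists_isIdempotentElem_pow_succ {M : Type*} [Monoid M] [Finite M] (x : M) :
    ∃ k : ℕ, IsIdempotentElem (x ^ (k + 1)) := by
  obtain ⟨i, j, hij, h⟩ : ∃ i j : ℕ, i < j ∧ x ^ i = x ^ j := by
    obtain ⟨i, j, hne, h⟩ := Finite.exists_ne_map_eq_of_infinite fun n : ℕ => x ^ n
    rcases lt_or_gt_of_ne hne with hlt | hlt
    · exact ⟨i, j, hlt, h⟩
    · exact ⟨j, i, hlt, h.symm⟩
  obtain ⟨p, rfl⟩ := Nat.exists_eq_add_of_lt hij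
  have step : ∀ m, x ^ (i + m + (p + 1)) = x ^ (i + m) := fun m => by
    rw [show i + m + (p + 1) = (i + p + 1) + m by ring, pow_add, ← h, ← pow_add]
  have steps : ∀ t m, x ^ (i + m + t * (p + 1)) = x ^ (i + m) := by
    intro t
    induction t with
    | zero => simp
    | succ t ih =>
      intro m
      rw [show i + m + (t + 1) * (p + 1) = i + (m + t * (p + 1)) + (p + 1) by ring, step,
        ← add_assoc, ih]
  refine ⟨i * (p + 1) + p, ?_⟩
  have hm : i * (p + 1) + p + 1 = i + (i * p + p + 1) := by ring
  have key := steps (i + 1) (i * p + p + 1)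
  rw [← hm] at key
  rw [IsIdempotentElem, ← pow_add]
  convert key using 2
  ring

section AbelianFactorisation

open scoped commutatorElement

variable {G : Type*} [Group G] {A B : Subgroup G}

/-- A factorisation `G = AB` can be read as `G = BA`. -/
theorem exists_mul_eq_swap (hAB : ∀ g : G, ∃ a ∈ A, ∃ b ∈ B, g = a * b) (g : G) :
    ∃ b ∈ B, ∃ a ∈ A, g = b * a := by
  obtain ⟨a, ha, b, hb, h⟩ := hAB g⁻¹
  exact ⟨b⁻¹, inv_mem hb, a⁻¹, inv_mem ha, by rw [← mul_inv_rev, ← h, inv_inv]⟩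

/-- If `G = AB`, a subgroup is normal once it is invariant under conjugation by `A` and `B`. -/
theorem normal_of_conj_mem_factors (hAB : ∀ g : G, ∃ a ∈ A, ∃ b ∈ B, g = a * b)
    (N : Subgroup G) (hA : ∀ a ∈ A, ∀ n ∈ N, a * n * a⁻¹ ∈ N)
    (hB : ∀ b ∈ B, ∀ n ∈ N, b * n * b⁻¹ ∈ N) : N.Normal := by
  refine ⟨fun n hn g => ?_⟩
  obtain ⟨a, ha, b, hb, rfl⟩ := hAB g
  have := hA a ha _ (hB b hb n hn)
  simpa [mul_assoc] using this

/-- Conjugating a commutator `⁅a, b⁆` by an element of `A`. -/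
theorem conj_commutatorElement_left (hA : ∀ x ∈ A, ∀ y ∈ A, x * y = y * x)
    {a a₁ b b₂ a₂ : G} (ha : a ∈ A) (ha₁ : a₁ ∈ A) (ha₂ : a₂ ∈ A)
    (h : a₁ * b * a₁⁻¹ = b₂ * a₂) : a₁ * ⁅a, b⁆ * a₁⁻¹ = ⁅a, b₂⁆ := by
  have e1 : a₁ * ⁅a, b⁆ * a₁⁻¹ = ⁅a₁ * a * a₁⁻¹, a₁ * b * a₁⁻¹⁆ := by
    simp only [commutatorElement_def]; group
  have e2 : a₁ * a * a₁⁻¹ = a := by rw [hA a₁ ha₁ a ha]; group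
  have e3 : a₂ * a⁻¹ * a₂⁻¹ = a⁻¹ := by rw [hA a₂ ha₂ a⁻¹ (inv_mem ha)]; group
  rw [e1, e2, h, commutatorElement_def, commutatorElement_def]
  calc a * (b₂ * a₂) * a⁻¹ * (b₂ * a₂)⁻¹ = a * b₂ * (a₂ * a⁻¹ * a₂⁻¹) * b₂⁻¹ := by group
    _ = _ := by rw [e3]

/-- Conjugating a commutator `⁅a, b⁆` by an element of `B`. -/
theorem conj_commutatorElement_right (hB : ∀ x ∈ B, ∀ y ∈ B, x * y = y * x)
    {a b b₁ a₃ b₃ : G} (hb : b ∈ B) (hb₁ : b₁ ∈ B) (hb₃ : b₃ ∈ B)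
    (h : b₁ * a * b₁⁻¹ = a₃ * b₃) : b₁ * ⁅a, b⁆ * b₁⁻¹ = ⁅a₃, b⁆ := by
  have e1 : b₁ * ⁅a, b⁆ * b₁⁻¹ = ⁅b₁ * a * b₁⁻¹, b₁ * b * b₁⁻¹⁆ := by
    simp only [commutatorElement_def]; group
  have e2 : b₁ * b * b₁⁻¹ = b := by rw [hB b₁ hb₁ b hb]; group
  have e3 : b₃ * b * b₃⁻¹ = b := by rw [hB b₃ hb₃ b hb]; group
  rw [e1, e2, h, commutatorElement_def, commutatorElement_def]
  calc a₃ * b₃ * b * (a₃ * b₃)⁻¹ * b⁻¹ = a₃ * (b₃ * b * b₃⁻¹) * a₃⁻¹ * b⁻¹ := by group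
    _ = _ := by rw [e3]

/-- If `G = AB`, then `⁅A, B⁆` is normal in `G`, for abelian `A` and `B`. -/
theorem normal_commutator_factors (hAB : ∀ g : G, ∃ a ∈ A, ∃ b ∈ B, g = a * b)
    (hA : ∀ x ∈ A, ∀ y ∈ A, x * y = y * x) (hB : ∀ x ∈ B, ∀ y ∈ B, x * y = y * x) :
    ⁅A, B⁆.Normal := by
  refine normal_of_conj_mem_factors hAB _ (fun a₁ ha₁ n hn => ?_) fun b₁ hb₁ n hn => ?_
  · suffices h : ⁅A, B⁆ ≤ ⁅A, B⁆.comap (MulAut.conj a₁).toMonoidHom from h hn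
    rw [Subgroup.commutator_le]
    intro a ha b hb
    obtain ⟨b₂, hb₂, a₂, ha₂, h⟩ := exists_mul_eq_swap hAB (a₁ * b * a₁⁻¹)
    change a₁ * ⁅a, b⁆ * a₁⁻¹ ∈ ⁅A, B⁆
    rw [conj_commutatorElement_left hA ha ha₁ ha₂ h]
    exact Subgroup.commutator_mem_commutator ha hb₂
  · suffices h : ⁅A, B⁆ ≤ ⁅A, B⁆.comap (MulAut.conj b₁).toMonoidHom from h hn
    rw [Subgroup.commutator_le]
    intro a ha b hb
    obtain ⟨a₃, ha₃, b₃, hb₃, h⟩ := hAB (b₁ * a * b₁⁻¹)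
    change b₁ * ⁅a, b⁆ * b₁⁻¹ ∈ ⁅A, B⁆
    rw [conj_commutatorElement_right hB hb hb₁ hb₃ h]
    exact Subgroup.commutator_mem_commutator ha₃ hb

/-- **Itô's theorem**: if `G = AB` with `A` and `B` abelian, then `⁅A, B⁆` is abelian. -/
theorem commutator_factors_comm (hAB : ∀ g : G, ∃ a ∈ A, ∃ b ∈ B, g = a * b)
    (hA : ∀ x ∈ A, ∀ y ∈ A, x * y = y * x) (hB : ∀ x ∈ B, ∀ y ∈ B, x * y = y * x) :
    ∀ x ∈ ⁅A, B⁆, ∀ y ∈ ⁅A, B⁆, x * y = y * x := by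
  have key : ∀ a ∈ A, ∀ b ∈ B, ∀ a₁ ∈ A, ∀ b₁ ∈ B,
      ⁅a, b⁆ * ⁅a₁, b₁⁆ = ⁅a₁, b₁⁆ * ⁅a, b⁆ := by
    intro a ha b hb a₁ ha₁ b₁ hb₁
    obtain ⟨b₂, hb₂, a₂, ha₂, h₂⟩ := exists_mul_eq_swap hAB (a₁⁻¹ * b * a₁)
    obtain ⟨a₃, ha₃, b₃, hb₃, h₃⟩ := hAB (b₁⁻¹ * a * b₁)
    replace h₂ : a₁⁻¹ * b * a₁⁻¹⁻¹ = b₂ * a₂ := by rwa [inv_inv]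
    replace h₃ : b₁⁻¹ * a * b₁⁻¹⁻¹ = a₃ * b₃ := by rwa [inv_inv]
    have e1 : b₁⁻¹ * (a₁⁻¹ * ⁅a, b⁆ * a₁⁻¹⁻¹) * b₁⁻¹⁻¹ = ⁅a₃, b₂⁆ := by
      rw [conj_commutatorElement_left hA ha (inv_mem ha₁) ha₂ h₂,
        conj_commutatorElement_right hB hb₂ (inv_mem hb₁) hb₃ h₃]
    have e2 : a₁⁻¹ * (b₁⁻¹ * ⁅a, b⁆ * b₁⁻¹⁻¹) * a₁⁻¹⁻¹ = ⁅a₃, b₂⁆ := by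
      rw [conj_commutatorElement_right hB hb (inv_mem hb₁) hb₃ h₃,
        conj_commutatorElement_left hA ha₃ (inv_mem ha₁) ha₂ h₂]
    have e3 := e1.trans e2.symm
    generalize ⁅a, b⁆ = c at *
    have e4 : c = a₁ * b₁ * (a₁⁻¹ * (b₁⁻¹ * c * b₁⁻¹⁻¹) * a₁⁻¹⁻¹) * b₁⁻¹ * a₁⁻¹ := by
      rw [← e3]; group
    calc c * ⁅a₁, b₁⁆ = _ := by rw [e4]
      _ = ⁅a₁, b₁⁆ * c := by simp only [commutatorElement_def]; group
  have hle : ⁅A, B⁆ ≤ Subgroup.centralizer ((⁅A, B⁆ : Subgroup G) : Set G) := by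
    rw [Subgroup.commutator_le]
    intro a ha b hb
    suffices h : ⁅A, B⁆ ≤ Subgroup.centralizer {⁅a, b⁆} by
      rw [Subgroup.mem_centralizer_iff]
      intro x hx
      exact (Subgroup.mem_centralizer_iff.mp (h hx) _ rfl).symm
    rw [Subgroup.commutator_le]
    intro a₁ ha₁ b₁ hb₁
    rw [Subgroup.mem_centralizer_iff]
    rintro _ rfl
    exact key a ha b hb a₁ ha₁ b₁ hb₁
  intro x hx y hy
  exact Subgroup.mem_centralizer_iff.mp (hle hy) x hx

/-- If `G = AB`, then `a⁻¹ * (g⁻¹ * a * g) ∈ ⁅A, B⁆` for `a ∈ A`, with `A` and `B` abelian. -/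
theorem inv_mul_conj_mem_commutator (hAB : ∀ g : G, ∃ a ∈ A, ∃ b ∈ B, g = a * b)
    (hA : ∀ x ∈ A, ∀ y ∈ A, x * y = y * x) {a : G} (ha : a ∈ A) (g : G) :
    a⁻¹ * (g⁻¹ * a * g) ∈ ⁅A, B⁆ := by
  obtain ⟨x, hx, b, hb, rfl⟩ := hAB g
  have e : x⁻¹ * a * x = a := by rw [hA _ (inv_mem hx) a ha]; group
  have := Subgroup.commutator_mem_commutator (inv_mem ha) (inv_mem hb)
  rw [commutatorElement_def] at this
  have h : a⁻¹ * ((x * b)⁻¹ * a * (x * b)) = a⁻¹ * b⁻¹ * a⁻¹⁻¹ * b⁻¹⁻¹ := by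
    calc a⁻¹ * ((x * b)⁻¹ * a * (x * b)) = a⁻¹ * b⁻¹ * (x⁻¹ * a * x) * b := by group
      _ = a⁻¹ * b⁻¹ * a⁻¹⁻¹ * b⁻¹⁻¹ := by rw [e]; group
  rwa [h]

/-- Suppose `G = AB` with `A`, `B` abelian, and let `x` be a non-trivial element of `K ∩ A`
centralising `⁅A, B⁆`. If `K ∩ B` has no non-trivial element centralising `A`, then `K ∩ A`
contains a non-trivial normal subgroup of `G`. -/
theorem exists_normal_le_of_commute (hAB : ∀ g : G, ∃ a ∈ A, ∃ b ∈ B, g = a * b)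
    (hA : ∀ x ∈ A, ∀ y ∈ A, x * y = y * x)
    {K : Subgroup G} [K.Normal] (hK : ∀ k ∈ K, ∃ a ∈ A ⊓ K, ∃ b ∈ B ⊓ K, k = a * b)
    (hC : ∀ y ∈ B ⊓ K, (∀ a ∈ A, a * y = y * a) → y = 1)
    [hD : ⁅A, B⁆.Normal] {x : G} (hx : x ∈ A ⊓ K) (hx1 : x ≠ 1)
    (hxD : ∀ d ∈ ⁅A, B⁆, d * x = x * d) :
    ∃ N : Subgroup G, N.Normal ∧ N ≠ ⊥ ∧ N ≤ A ⊓ K := by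
  refine ⟨K ⊓ Subgroup.centralizer ((⁅A, B⁆ : Subgroup G) : Set G) ⊓
    Subgroup.centralizer (A : Set G),
    ⟨?_⟩, ?_, ?_⟩
  · rintro n ⟨⟨hnK, hnD⟩, hnA⟩ g
    have hnD' := (inferInstance :
      (Subgroup.centralizer ((⁅A, B⁆ : Subgroup G) : Set G)).Normal).conj_mem n hnD g
    refine ⟨⟨‹K.Normal›.conj_mem n hnK g, hnD'⟩, ?_⟩
    refine Subgroup.mem_centralizer_iff.mpr fun a ha => ?_
    have h1 := Subgroup.mem_centralizer_iff.mp hnD _ (inv_mul_conj_mem_commutator hAB hA ha g)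
    have h2 := Subgroup.mem_centralizer_iff.mp hnA a ha
    have h3 : g⁻¹ * a * g * n = n * (g⁻¹ * a * g) := by
      calc g⁻¹ * a * g * n = a * (a⁻¹ * (g⁻¹ * a * g) * n) := by group
        _ = a * n * (a⁻¹ * (g⁻¹ * a * g)) := by rw [h1]; group
        _ = n * (g⁻¹ * a * g) := by rw [h2]; group
    calc a * (g * n * g⁻¹) = g * (g⁻¹ * a * g * n) * g⁻¹ := by group
      _ = g * n * g⁻¹ * a := by rw [h3]; group
  · intro h
    apply hx1
    rw [← Subgroup.mem_bot, ← h]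
    exact ⟨⟨hx.2, Subgroup.mem_centralizer_iff.mpr hxD⟩,
      Subgroup.mem_centralizer_iff.mpr fun a ha => hA a ha x hx.1⟩
  · rintro n ⟨⟨hnK, -⟩, hnA⟩
    obtain ⟨a, ha, b, hb, rfl⟩ := hK n hnK
    have : b = 1 := hC b hb fun c hc => by
      have h1 : c * (a * b) = a * b * c := Subgroup.mem_centralizer_iff.mp hnA c hc
      apply mul_left_cancel (a := a)
      rw [← mul_assoc, ← hA c hc a ha.1, mul_assoc, h1, mul_assoc]
    simpa [this] using ha

/-- Given a normal abelian subgroup `D`, the endomorphism `d ↦ a⁻¹ d a d⁻¹` of `D`. -/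
def commutatorEnd (D : Subgroup G) [D.Normal] (hD : ∀ x ∈ D, ∀ y ∈ D, x * y = y * x) (a : G) :
    Monoid.End D where
  toFun d := ⟨a⁻¹ * d * a * (d : G)⁻¹,
    mul_mem (by simpa using ‹D.Normal›.conj_mem d d.2 a⁻¹) (inv_mem d.2)⟩
  map_one' := by ext; simp
  map_mul' x y := by
    ext
    have hx := ‹D.Normal›.conj_mem y y.2 a⁻¹
    have h := hD (a⁻¹ * y * a⁻¹⁻¹ * (y : G)⁻¹) (mul_mem hx (inv_mem y.2)) (x : G)⁻¹ (inv_mem x.2)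
    rw [inv_inv] at h
    simp only [Subgroup.coe_mul]
    calc a⁻¹ * (x * y) * a * ((x : G) * y)⁻¹
        = a⁻¹ * x * a * (a⁻¹ * y * a * (y : G)⁻¹ * (x : G)⁻¹) := by group
      _ = _ := by rw [h]; group

theorem coe_commutatorEnd (D : Subgroup G) [D.Normal] (hD : ∀ x ∈ D, ∀ y ∈ D, x * y = y * x)
    (a : G) (d : D) : (commutatorEnd D hD a d : G) = a⁻¹ * d * a * (d : G)⁻¹ := rfl

/-- Suppose `G = AB` is finite with `A`, `B` abelian, `a ∈ A` and `c ∈ B` are congruent modulo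
`D = ⁅A, B⁆`. If `a` acts fixed point freely on a normal subgroup `N` of `G` contained in
`D ∩ (A ∩ K)(B ∩ K)`, then `N` is trivial. -/
theorem eq_one_of_fixedPointFree [Finite G] (hAB : ∀ g : G, ∃ a ∈ A, ∃ b ∈ B, g = a * b)
    (hA : ∀ x ∈ A, ∀ y ∈ A, x * y = y * x) (hB : ∀ x ∈ B, ∀ y ∈ B, x * y = y * x)
    {D N : Subgroup G} [D.Normal] [N.Normal] (hD : ∀ x ∈ D, ∀ y ∈ D, x * y = y * x) (hND : N ≤ D)
    {a c : G} (ha : a ∈ A) (hc : c ∈ B) (hac : a⁻¹ * c ∈ D)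
    (hfix : ∀ n ∈ N, a⁻¹ * n * a = n → n = 1) : ∀ n ∈ N, n = 1 := by
  obtain ⟨g, rfl⟩ : ∃ g : D, c = a * g := ⟨⟨a⁻¹ * c, hac⟩, by simp⟩
  set φ := commutatorEnd D hD a with hφ
  have : Finite (Monoid.End D) :=
    Finite.of_injective (fun f : Monoid.End D => (f : D → D)) DFunLike.coe_injective
  obtain ⟨k, hk⟩ := exists_isIdempotentElem_pow_succ φ
  set ψ := φ ^ (k + 1) with hψ
  have hconj : ∀ x ∈ A, ∀ d : D,
      ψ (MulAut.conjNormal x d) = MulAut.conjNormal x (ψ d) := by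
    intro x hx d
    have hcomm : Commute φ ((MulAut.conjNormal x : MulAut D).toMonoidHom : Monoid.End D) := by
      refine MonoidHom.ext fun e => Subtype.ext ?_
      change (φ (MulAut.conjNormal x e) : G) = (MulAut.conjNormal x (φ e) : D)
      rw [MulAut.conjNormal_apply, hφ, coe_commutatorEnd, coe_commutatorEnd,
        MulAut.conjNormal_apply]
      have h1 := hA x hx a ha
      have h2 : a⁻¹ * x = x * a⁻¹ := hA _ (inv_mem ha) x hx
      have h3 : x⁻¹ * a = a * x⁻¹ := hA _ (inv_mem hx) a ha
      calc a⁻¹ * (x * e * x⁻¹) * a * (x * (e : G) * x⁻¹)⁻¹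
          = (a⁻¹ * x) * e * (x⁻¹ * a) * x * (e : G)⁻¹ * x⁻¹ := by group
        _ = _ := by rw [h2, h3]; group
    exact DFunLike.congr_fun (hcomm.pow_left (k + 1)).eq d
  have hψψ : ∀ d, ψ (ψ d) = ψ d := fun d => DFunLike.congr_fun hk.eq d
  have hψg : ψ g = 1 := by
    set y : D := ((φ ^ k) g)⁻¹ with hy
    have hφy : φ y = (ψ g)⁻¹ := by
      rw [hy, map_inv, hψ, pow_succ']
      rfl
    have hker : ψ (g * φ y) = 1 := by rw [map_mul, hφy, map_inv, hψψ, mul_inv_cancel]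
    obtain ⟨α, hα, β, hβ, hαβ⟩ := hAB y
    have hβc : β * (a * g) * β⁻¹ = a * g := by rw [hB β hβ _ hc]; group
    have e1 : (y : G) * (a * g) * (y : G)⁻¹ = a * (g * φ y : D) := by
      have h := hD g g.2 _ (φ y).2
      rw [Subgroup.coe_mul, h, hφ, coe_commutatorEnd]
      have h' := hD (y : G)⁻¹ (inv_mem y.2) g g.2
      calc (y : G) * (a * g) * (y : G)⁻¹ = y * a * (g * (y : G)⁻¹) := by group
        _ = _ := by rw [← h']; group
    have e2 : (y : G) * (a * g) * (y : G)⁻¹ = α * (a * g) * α⁻¹ := by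
      rw [hαβ]
      calc α * β * (a * g) * (α * β)⁻¹ = α * (β * (a * g) * β⁻¹) * α⁻¹ := by group
        _ = _ := by rw [hβc]
    have e3 : MulAut.conjNormal α g = g * φ y := by
      apply Subtype.ext
      rw [MulAut.conjNormal_apply]
      apply mul_left_cancel (a := a)
      rw [← e1, e2]
      calc a * (α * g * α⁻¹) = (a * α) * g * α⁻¹ := by group
        _ = _ := by rw [hA a ha α hα]; group
    rw [← e3, hconj α hα] at hker
    simpa using hker
  have hinj : ∀ j : ℕ, ∀ d : D, (d : G) ∈ N → (φ ^ j) d = 1 → d = 1 := by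
    intro j
    induction j with
    | zero => exact fun d _ h => h
    | succ j ih =>
      intro d hd h
      rw [pow_succ] at h
      have hφd : φ d = 1 := by
        refine ih (φ d) ?_ h
        rw [hφ, coe_commutatorEnd]
        exact mul_mem (by simpa using ‹N.Normal›.conj_mem d hd a⁻¹) (inv_mem hd)
      apply Subtype.ext
      refine hfix d hd ?_
      have := congrArg (Subtype.val) hφd
      rw [hφ, coe_commutatorEnd] at this
      exact mul_inv_eq_one.mp this
  intro n hn
  set d : D := ⟨n, hND hn⟩ with hd
  suffices h : d = 1 from congrArg Subtype.val h
  obtain ⟨l, hl, m, hm, hlm⟩ := hAB n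
  have e1 : φ d = MulAut.conjNormal l g * g⁻¹ := by
    apply Subtype.ext
    rw [hφ, coe_commutatorEnd, Subgroup.coe_mul, MulAut.conjNormal_apply]
    change a⁻¹ * n * a * n⁻¹ = _
    have h1 : a⁻¹ * l = l * a⁻¹ := hA _ (inv_mem ha) l hl
    have h2 : (g : G)⁻¹ * a⁻¹ * m * (a * g) = m := by
      rw [← mul_inv_rev, mul_assoc, hB m hm _ hc]; group
    have h3 : n * (g : G)⁻¹ = (g : G)⁻¹ * n := hD n (hND hn) _ (inv_mem g.2)
    calc a⁻¹ * n * a * n⁻¹ = (a⁻¹ * l) * m * a * n⁻¹ := by rw [hlm]; group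
      _ = l * g * ((g : G)⁻¹ * a⁻¹ * m * (a * g)) * (g : G)⁻¹ * n⁻¹ := by rw [h1]; group
      _ = l * g * l⁻¹ * (n * (g : G)⁻¹) * n⁻¹ := by rw [h2, hlm]; group
      _ = _ := by rw [h3, Subgroup.coe_inv]; group
  have e2 : (φ ^ (k + 1 + 1)) d = 1 := by
    rw [pow_succ]
    change ψ (φ d) = 1
    rw [e1, map_mul, hconj l hl, map_inv, hψg]
    simp
  exact hinj _ d hn e2

/-- If a finite group `G = AB` with `A`, `B` abelian has a non-trivial normal subgroup
`K = (A ∩ K)(B ∩ K)`, then `A ∩ K` or `B ∩ K` contains a non-trivial normal subgroup of `G`. -/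
theorem exists_normal_le_factor_inf [Finite G] (hAB : ∀ g : G, ∃ a ∈ A, ∃ b ∈ B, g = a * b)
    (hA : ∀ x ∈ A, ∀ y ∈ A, x * y = y * x) (hB : ∀ x ∈ B, ∀ y ∈ B, x * y = y * x)
    {K : Subgroup G} [K.Normal] (hK1 : K ≠ ⊥)
    (hK : ∀ k ∈ K, ∃ a ∈ A ⊓ K, ∃ b ∈ B ⊓ K, k = a * b) :
    ∃ N : Subgroup G, N.Normal ∧ N ≠ ⊥ ∧ (N ≤ A ⊓ K ∨ N ≤ B ⊓ K) := by
  have hDn := normal_commutator_factors hAB hA hB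
  have hDc := commutator_factors_comm hAB hA hB
  by_contra! hcon
  have hcentral : ∀ x, (∀ g, g * x = x * g) → x ∈ A ⊓ K ∨ x ∈ B ⊓ K → x = 1 := by
    intro x hx hx'
    by_contra hx1
    have hN : (Subgroup.zpowers x).Normal := by
      have hle : Subgroup.zpowers x ≤ Subgroup.center G :=
        Subgroup.zpowers_le.mpr (Subgroup.mem_center_iff.mpr hx)
      refine ⟨fun n hn g => ?_⟩
      rwa [Subgroup.mem_center_iff.mp (hle hn) g, mul_inv_cancel_right]
    have := hcon _ hN (by simpa using hx1)
    simp only [Subgroup.zpowers_le] at this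
    tauto
  have hCA : ∀ y ∈ A ⊓ K, (∀ b ∈ B, b * y = y * b) → y = 1 := fun y hy h =>
    hcentral y (fun g => by
      obtain ⟨a, ha, b, hb, rfl⟩ := hAB g
      rw [mul_assoc, h b hb, ← mul_assoc, hA a ha y hy.1, mul_assoc]) (Or.inl hy)
  have hCB : ∀ y ∈ B ⊓ K, (∀ a ∈ A, a * y = y * a) → y = 1 := fun y hy h =>
    hcentral y (fun g => by
      obtain ⟨a, ha, b, hb, rfl⟩ := hAB g
      rw [mul_assoc, hB b hb y hy.1, ← mul_assoc, h a ha, mul_assoc]) (Or.inr hy)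
  have hQA : ∀ x ∈ A ⊓ K, (∀ d ∈ ⁅A, B⁆, d * x = x * d) → x = 1 := by
    intro x hx hxD
    by_contra hx1
    obtain ⟨N, hN, hN1, hle⟩ := exists_normal_le_of_commute hAB hA hK hCB hx hx1 hxD
    exact (hcon N hN hN1).1 hle
  have hQB : ∀ x ∈ B ⊓ K, (∀ d ∈ ⁅A, B⁆, d * x = x * d) → x = 1 := by
    intro x hx hxD
    by_contra hx1
    have hKBA : ∀ k ∈ K, ∃ b ∈ B ⊓ K, ∃ a ∈ A ⊓ K, k = b * a := by
      intro k hk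
      obtain ⟨a, ha, b, hb, h⟩ := hK k⁻¹ (inv_mem hk)
      exact ⟨b⁻¹, inv_mem hb, a⁻¹, inv_mem ha, by rw [← mul_inv_rev, ← h, inv_inv]⟩
    have hDn' : ⁅B, A⁆.Normal := by rwa [Subgroup.commutator_comm]
    obtain ⟨N, hN, hN1, hle⟩ := exists_normal_le_of_commute (exists_mul_eq_swap hAB) hB hKBA hCA
      hx hx1 (by rwa [Subgroup.commutator_comm])
    exact (hcon N hN hN1).2 hle
  have hR : ∀ z ∈ K, (∀ d ∈ ⁅A, B⁆, d * z = z * d) →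
      (∀ a ∈ A, ∀ c ∈ B, a⁻¹ * c ∈ ⁅A, B⁆ → a * z = z * a) → z = 1 := by
    intro z hz hzD hzA
    obtain ⟨l, hl, m, hm, rfl⟩ := hK z hz
    have hzB : ∀ a ∈ A, ∀ c ∈ B, a⁻¹ * c ∈ ⁅A, B⁆ → c * (l * m) = l * m * c := by
      intro a ha c hc hac
      calc c * (l * m) = a * (a⁻¹ * c * (l * m)) := by group
        _ = (a * (l * m)) * (a⁻¹ * c) := by rw [hzD _ hac]; group
        _ = l * m * c := by rw [hzA a ha c hc hac]; group
    have hlA : ∀ a ∈ A, a * l = l * a := fun a ha => hA a ha l hl.1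
    have hmB : ∀ c ∈ B, c * m = m * c := fun c hc => hB c hc m hm.1
    have hlB : ∀ a ∈ A, ∀ c ∈ B, a⁻¹ * c ∈ ⁅A, B⁆ → c * l = l * c := by
      intro a ha c hc hac
      apply mul_right_cancel (b := m)
      rw [mul_assoc, hzB a ha c hc hac, mul_assoc, ← hmB c hc, mul_assoc]
    have hmA : ∀ a ∈ A, ∀ c ∈ B, a⁻¹ * c ∈ ⁅A, B⁆ → a * m = m * a := by
      intro a ha c hc hac
      apply mul_left_cancel (a := l)
      rw [← mul_assoc, ← hlA a ha, mul_assoc, hzA a ha c hc hac, mul_assoc]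
    have hD : ∀ d ∈ ⁅A, B⁆, ∃ a ∈ A, ∃ c ∈ B, a⁻¹ * c ∈ ⁅A, B⁆ ∧ d = a⁻¹ * c := by
      intro d hd
      obtain ⟨a, ha, c, hc, rfl⟩ := hAB d
      exact ⟨a⁻¹, inv_mem ha, c, hc, by simpa using hd, by simp⟩
    have hl1 : l = 1 := hQA l hl fun d hd => by
      obtain ⟨a, ha, c, hc, hac, rfl⟩ := hD d hd
      rw [mul_assoc, hlB a ha c hc hac, ← mul_assoc, hlA _ (inv_mem ha), mul_assoc]
    have hm1 : m = 1 := hQB m hm fun d hd => by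
      obtain ⟨a, ha, c, hc, hac, rfl⟩ := hD d hd
      have := hmA a ha c hc hac
      have h' : a⁻¹ * m = m * a⁻¹ := by
        rw [inv_mul_eq_iff_eq_mul, ← mul_assoc, this, mul_assoc, mul_inv_cancel, mul_one]
      rw [mul_assoc, hmB c hc, ← mul_assoc, h', mul_assoc]
    rw [hl1, hm1, mul_one]
  have hM : K ⊓ ⁅A, B⁆ ≠ ⊥ := by
    intro hM
    have hcomm : ∀ a ∈ A, ∀ b ∈ B, a ∈ K ∨ b ∈ K → b * a = a * b := by
      intro a ha b hb h
      have hmem : ⁅a, b⁆ ∈ K := by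
        rcases h with h | h
        · exact Subgroup.commutator_le_left K ⊤
            (Subgroup.commutator_mem_commutator h (Subgroup.mem_top b))
        · exact Subgroup.commutator_le_right ⊤ K
            (Subgroup.commutator_mem_commutator (Subgroup.mem_top a) h)
      have : ⁅a, b⁆ ∈ K ⊓ ⁅A, B⁆ := ⟨hmem, Subgroup.commutator_mem_commutator ha hb⟩
      rw [hM, Subgroup.mem_bot, commutatorElement_eq_one_iff_mul_comm] at this
      exact this.symm
    apply hK1
    rw [Subgroup.eq_bot_iff_forall]
    intro k hk
    obtain ⟨l, hl, m, hm, rfl⟩ := hK k hk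
    rw [hCA l hl fun b hb => hcomm l hl.1 b hb (Or.inl hl.2),
      hCB m hm fun a ha => (hcomm a ha m hm.1 (Or.inr hm.2)).symm, mul_one]
  obtain ⟨N, ⟨hNn, hN1, hNM⟩, hmin⟩ :=
    (Set.toFinite {N : Subgroup G | N.Normal ∧ N ≠ ⊥ ∧ N ≤ K ⊓ ⁅A, B⁆}).exists_minimal
      ⟨K ⊓ ⁅A, B⁆, inferInstance, hM, le_rfl⟩
  obtain ⟨n, hn, hn1⟩ := N.bot_or_exists_ne_one.resolve_left hN1
  obtain ⟨a, ha, c, hc, hac, hne⟩ : ∃ a ∈ A, ∃ c ∈ B, a⁻¹ * c ∈ ⁅A, B⁆ ∧ a * n ≠ n * a := by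
    by_contra! h
    exact hn1 (hR n (hNM hn).1 (fun d hd => hDc d hd n (hNM hn).2) h)
  have hCn : (N ⊓ Subgroup.centralizer {a}).Normal := by
    refine ⟨fun x hx g => ⟨hNn.conj_mem x hx.1 g, ?_⟩⟩
    refine Subgroup.mem_centralizer_singleton_iff.mpr (Eq.symm ?_)
    have h1 := hDc _ (inv_mul_conj_mem_commutator hAB hA ha g) x (hNM hx.1).2
    have h2 := Subgroup.mem_centralizer_iff.mp hx.2 _ rfl
    have h3 : g⁻¹ * a * g * x = x * (g⁻¹ * a * g) := by
      calc g⁻¹ * a * g * x = a * (a⁻¹ * (g⁻¹ * a * g) * x) := by group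
        _ = a * x * (a⁻¹ * (g⁻¹ * a * g)) := by rw [h1]; group
        _ = x * (g⁻¹ * a * g) := by rw [h2]; group
    calc a * (g * x * g⁻¹) = g * (g⁻¹ * a * g * x) * g⁻¹ := by group
      _ = g * x * g⁻¹ * a := by rw [h3]; group
  have hCbot : N ⊓ Subgroup.centralizer {a} = ⊥ := by
    by_contra hne'
    have := hmin ⟨hCn, hne', inf_le_left.trans hNM⟩ inf_le_left hn
    exact hne (Subgroup.mem_centralizer_iff.mp this.2 _ rfl)
  refine hn1 (eq_one_of_fixedPointFree hAB hA hB hDc (hNM.trans inf_le_right) ha hc hac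
    (fun x hx h => ?_) n hn)
  rw [← Subgroup.mem_bot, ← hCbot]
  refine ⟨hx, Subgroup.mem_centralizer_singleton_iff.mpr (Eq.symm ?_)⟩
  calc a * x = a * (a⁻¹ * x * a) := by rw [h]
    _ = x * a := by group

end AbelianFactorisation

/-- The set `LH ∩ LE` as a subgroup, when its elements commute pairwise. -/
def mulInterSubgroup {G : Type*} [Group G] (L H E : Subgroup G)
    (hT : ∀ a ∈ ((L : Set G) * (H : Set G)) ∩ ((L : Set G) * (E : Set G)),
      ∀ b ∈ ((L : Set G) * (H : Set G)) ∩ ((L : Set G) * (E : Set G)), a * b = b * a) :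
    Subgroup G :=
  have hL : ∀ l ∈ L, l ∈ ((L : Set G) * (H : Set G)) ∩ ((L : Set G) * (E : Set G)) :=
    fun l hl => ⟨⟨l, hl, 1, H.one_mem, mul_one l⟩, ⟨l, hl, 1, E.one_mem, mul_one l⟩⟩
  have hmul : ∀ X : Subgroup G, ∀ x ∈ ((L : Set G) * (H : Set G)) ∩ ((L : Set G) * (E : Set G)),
      x ∈ (L : Set G) * (X : Set G) → ∀ y ∈ (L : Set G) * (X : Set G),
      x * y ∈ (L : Set G) * (X : Set G) := by
    rintro X _ hx ⟨l, hl, h, hh, rfl⟩ _ ⟨l', hl', h', hh', rfl⟩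
    have := hT _ hx l' (hL l' hl')
    refine ⟨l' * l, mul_mem hl' hl, h * h', mul_mem hh hh', ?_⟩
    calc l' * l * (h * h') = l' * (l * h) * h' := by group
      _ = l * h * (l' * h') := by rw [← this]; group
  have hinv : ∀ X : Subgroup G, ∀ x ∈ ((L : Set G) * (H : Set G)) ∩ ((L : Set G) * (E : Set G)),
      x ∈ (L : Set G) * (X : Set G) → x⁻¹ ∈ (L : Set G) * (X : Set G) := by
    rintro X _ hx ⟨l, hl, h, hh, rfl⟩
    have := hT _ hx l (hL l hl)
    refine ⟨l⁻¹, inv_mem hl, h⁻¹, inv_mem hh, ?_⟩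
    have h' : h * l = l * h := by simpa [mul_assoc] using this
    change l⁻¹ * h⁻¹ = (l * h)⁻¹
    rw [← h', mul_inv_rev]
  { carrier := ((L : Set G) * (H : Set G)) ∩ ((L : Set G) * (E : Set G))
    one_mem' := hL 1 L.one_mem
    mul_mem' := fun {x y} hx hy => ⟨hmul H x hx hx.1 y hy.1, hmul E x hx hx.2 y hy.2⟩
    inv_mem' := fun {x} hx => ⟨hinv H x hx hx.1, hinv E x hx hx.2⟩ }

theorem mem_mulInterSubgroup {G : Type*} [Group G] {L H E : Subgroup G}
    {hT : ∀ a ∈ ((L : Set G) * (H : Set G)) ∩ ((L : Set G) * (E : Set G)),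
      ∀ b ∈ ((L : Set G) * (H : Set G)) ∩ ((L : Set G) * (E : Set G)), a * b = b * a} {x : G} :
    x ∈ mulInterSubgroup L H E hT ↔
      x ∈ ((L : Set G) * (H : Set G)) ∩ ((L : Set G) * (E : Set G)) := Iff.rfl

theorem le_mulInterSubgroup {G : Type*} [Group G] {L H E : Subgroup G}
    {hT : ∀ a ∈ ((L : Set G) * (H : Set G)) ∩ ((L : Set G) * (E : Set G)),
      ∀ b ∈ ((L : Set G) * (H : Set G)) ∩ ((L : Set G) * (E : Set G)), a * b = b * a} :
    L ≤ mulInterSubgroup L H E hT := fun l hl =>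
  ⟨⟨l, hl, 1, H.one_mem, mul_one l⟩, ⟨l, hl, 1, E.one_mem, mul_one l⟩⟩

theorem mem_mulInterSubgroup_of_mem {G : Type*} [Group G] {L H E : Subgroup G}
    {hT : ∀ a ∈ ((L : Set G) * (H : Set G)) ∩ ((L : Set G) * (E : Set G)),
      ∀ b ∈ ((L : Set G) * (H : Set G)) ∩ ((L : Set G) * (E : Set G)), a * b = b * a} {x : G}
    (hx : x ∈ ((L : Set G) * (H : Set G)) ∩ (E : Set G)) : x ∈ mulInterSubgroup L H E hT :=
  ⟨hx.1, 1, L.one_mem, x, hx.2, one_mul x⟩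

theorem mulInterSubgroup_inf_le {G : Type*} [Group G] {K L H E : Subgroup G} (hLK : L ≤ K)
    (hKE : K ⊓ E = ⊥)
    {hT : ∀ a ∈ ((L : Set G) * (H : Set G)) ∩ ((L : Set G) * (E : Set G)),
      ∀ b ∈ ((L : Set G) * (H : Set G)) ∩ ((L : Set G) * (E : Set G)), a * b = b * a} :
    mulInterSubgroup L H E hT ⊓ K ≤ L := by
  rintro _ ⟨⟨-, l, hl, e, he, rfl⟩, hx⟩
  have : e ∈ K ⊓ E := ⟨(K.mul_mem_cancel_left (hLK hl)).mp hx, he⟩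
  rw [hKE, Subgroup.mem_bot] at this
  simpa [this] using hl

/-- In a finite non-trivial trifactorised group with `K = L₁L₂`, `E = E₁E₂`
(`Eᵢ = LᵢH ∩ E`), `LᵢH ∩ LᵢE` abelian and `[E,L₁] ≤ L₁`, there is a
non-trivial normal subgroup of `G` contained in `L₁` or in `L₂`. -/
theorem exists_normal_in_factor {G : Type*} [Group G] [Finite G] [Nontrivial G]
    (K H E : Subgroup G) [K.Normal]
    (hKE : (K : Set G) * (E : Set G) = Set.univ)
    (hKH : (K : Set G) * (H : Set G) = Set.univ)
    (hHE : (H : Set G) * (E : Set G) = Set.univ)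
    (hKEt : K ⊓ E = ⊥) (hHEt : H ⊓ E = ⊥)
    (L₁ L₂ : Subgroup G) (hL₁ : L₁ ≤ K) (hL₂ : L₂ ≤ K)
    (hE : (((L₁ : Set G) * (H : Set G)) ∩ (E : Set G)) *
        (((L₂ : Set G) * (H : Set G)) ∩ (E : Set G)) = (E : Set G))
    (hK : (L₁ : Set G) * (L₂ : Set G) = (K : Set G))
    (hT₁ : ∀ a ∈ ((L₁ : Set G) * (H : Set G)) ∩ ((L₁ : Set G) * (E : Set G)),
      ∀ b ∈ ((L₁ : Set G) * (H : Set G)) ∩ ((L₁ : Set G) * (E : Set G)), a * b = b * a)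
    (hT₂ : ∀ a ∈ ((L₂ : Set G) * (H : Set G)) ∩ ((L₂ : Set G) * (E : Set G)),
      ∀ b ∈ ((L₂ : Set G) * (H : Set G)) ∩ ((L₂ : Set G) * (E : Set G)), a * b = b * a)
    (hEL₁ : ∀ e ∈ E, ∀ l ∈ L₁, e * l * e⁻¹ * l⁻¹ ∈ L₁) :
    ∃ N : Subgroup G, N.Normal ∧ N ≠ ⊥ ∧ (N ≤ L₁ ∨ N ≤ L₂) := by
  have hK1 : K ≠ ⊥ := by
    rintro rfl
    have hE' : E = ⊤ := by
      rw [← SetLike.coe_set_eq, Subgroup.coe_top, ← hKE]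
      simp
    have hH' : H = ⊤ := by
      rw [← SetLike.coe_set_eq, Subgroup.coe_top, ← hKH]
      simp
    rw [hE', hH', inf_top_eq] at hHEt
    exact top_ne_bot hHEt
  have hAB : ∀ g : G, ∃ b ∈ mulInterSubgroup L₂ H E hT₂, ∃ a ∈ mulInterSubgroup L₁ H E hT₁,
      g = b * a := by
    intro g
    obtain ⟨k, hk, e, he, rfl⟩ : g ∈ (K : Set G) * (E : Set G) := hKE ▸ Set.mem_univ g
    have hk' : k⁻¹ ∈ (L₁ : Set G) * (L₂ : Set G) := by rw [hK]; exact inv_mem hk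
    obtain ⟨l₁, hl₁, l₂, hl₂, hl⟩ := hk'
    have he' : e⁻¹ ∈ (((L₁ : Set G) * (H : Set G)) ∩ (E : Set G)) *
        (((L₂ : Set G) * (H : Set G)) ∩ (E : Set G)) := by rw [hE]; exact inv_mem he
    obtain ⟨e₁, he₁, e₂, he₂, hee⟩ := he'
    have hconj : e₂ * l₁⁻¹ * e₂⁻¹ ∈ L₁ := by
      have := mul_mem (hEL₁ e₂ he₂.2 l₁⁻¹ (inv_mem hl₁)) (inv_mem hl₁)
      simpa using this
    refine ⟨l₂⁻¹ * e₂⁻¹,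
      mul_mem (le_mulInterSubgroup (inv_mem hl₂)) (inv_mem (mem_mulInterSubgroup_of_mem he₂)),
      e₂ * l₁⁻¹ * e₂⁻¹ * e₁⁻¹,
      mul_mem (le_mulInterSubgroup hconj) (inv_mem (mem_mulInterSubgroup_of_mem he₁)), ?_⟩
    change k * e = _
    rw [← inv_inv k, ← inv_inv e, ← hl, ← hee]
    group
  obtain ⟨N, hN, hN1, h⟩ := exists_normal_le_factor_inf (exists_mul_eq_swap hAB)
    hT₁ hT₂ hK1 fun k hk => by
      obtain ⟨l₁, hl₁, l₂, hl₂, rfl⟩ : k ∈ (L₁ : Set G) * (L₂ : Set G) := by rw [hK]; exact hk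
      exact ⟨l₁, ⟨le_mulInterSubgroup hl₁, hL₁ hl₁⟩, l₂, ⟨le_mulInterSubgroup hl₂, hL₂ hl₂⟩, rfl⟩
  exact ⟨N, hN, hN1, h.imp (fun h => h.trans (mulInterSubgroup_inf_le hL₁ hKEt))
    fun h => h.trans (mulInterSubgroup_inf_le hL₂ hKEt)⟩
end

section
/- Let B be a finite non-zero skew left brace with B = A₁ + A₂ a sum of two abelian subbraces A₁ and A₂, where A₁ is a left ideal of B. Then there exists a non-zero strong left ideal of B contained in A₁ or in A₂. -/
/-- A skew left brace: a set with two group structures `(B,+)` and `(B,·)`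
satisfying `a(b+c) = ab - a + ac`. -/
class SkewBrace (B : Type*) extends AddGroup B, Group B where
  mul_add_dist : ∀ a b c : B, a * (b + c) = a * b + -a + a * c

namespace SkewBrace

variable {B : Type*} [SkewBrace B]

/-- The lambda map `λ_a(b) = -a + ab`. -/
def lam (a b : B) : B := -a + a * b

/-- The star product `a * b = -a + ab - b`. -/
def star (a b : B) : B := -a + a * b + -b

/-- A subbrace: a subgroup of `(B,+)` that is also a subgroup of `(B,·)`. -/
def IsSubbrace (S : Set B) : Prop :=
  ((0 : B) ∈ S ∧ (∀ a ∈ S, ∀ b ∈ S, a + b ∈ S) ∧ (∀ a ∈ S, -a ∈ S)) ∧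
  ((1 : B) ∈ S ∧ (∀ a ∈ S, ∀ b ∈ S, a * b ∈ S) ∧ (∀ a ∈ S, a⁻¹ ∈ S))

/-- A left ideal: a subbrace with `B * S ⊆ S`. -/
def IsLeftIdeal (S : Set B) : Prop :=
  IsSubbrace S ∧ ∀ b : B, ∀ a ∈ S, star b a ∈ S

/-- A strong left ideal: a left ideal normal in `(B,+)`. -/
def IsStrongLeftIdeal (S : Set B) : Prop :=
  IsLeftIdeal S ∧ ∀ b : B, ∀ a ∈ S, b + a + -b ∈ S

/-- An ideal: a strong left ideal which is also a right ideal. -/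
def IsIdeal (S : Set B) : Prop :=
  IsStrongLeftIdeal S ∧ ∀ a ∈ S, ∀ b : B, star a b ∈ S

/-- A trivial subbrace: both operations coincide on it. -/
def IsTrivialSubbrace (S : Set B) : Prop :=
  IsSubbrace S ∧ ∀ a ∈ S, ∀ b ∈ S, a * b = a + b

/-- An abelian subbrace: a trivial subbrace whose group is abelian. -/
def IsAbelianSubbrace (S : Set B) : Prop :=
  IsTrivialSubbrace S ∧ ∀ a ∈ S, ∀ b ∈ S, a + b = b + a

end SkewBrace

open scoped commutatorElement

theorem exists_ne_forall_eq_of_assoc_comm {M : Type*} [Finite M] [Nontrivial M]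
    (m : M → M → M) (o : M) (comm : ∀ x y, m x y = m y x)
    (assoc : ∀ x y z, m (m x y) z = m x (m y z)) (h0 : ∀ x, m x o = o)
    (h : ∀ p v, m p v = v → v = o) :
    ∃ z, z ≠ o ∧ ∀ x, m z x = o := by
  have : Nonempty {z : M // z ≠ o} := nonempty_subtype.2 (exists_ne o)
  obtain ⟨⟨z, hz⟩, hmax⟩ := Finite.exists_max
    (fun z : {z : M // z ≠ o} => {x : M | m z.1 x = o}.ncard)
  refine ⟨z, hz, fun e => ?_⟩
  by_contra hze
  have hiter : ∀ n x, ∃ p, (m e)^[n + 1] x = m p x := by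
    intro n
    induction n with
    | zero => exact fun x => ⟨e, rfl⟩
    | succ n ih =>
      intro x
      obtain ⟨p, hp⟩ := ih x
      exact ⟨m e p, by rw [Function.iterate_succ_apply', hp, assoc]⟩
  have hex : ∃ n, (m e)^[n] z = o := by
    obtain ⟨i, j, hne, heq⟩ := Finite.exists_ne_map_eq_of_infinite (fun n : ℕ => (m e)^[n] z)
    wlog hlt : i < j generalizing i j
    · exact this j i hne.symm heq.symm (by omega)
    obtain ⟨k, rfl⟩ := Nat.exists_eq_add_of_lt hlt
    obtain ⟨p, hp⟩ := hiter k ((m e)^[i] z)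
    refine ⟨i, h p _ ?_⟩
    rw [← hp, ← Function.iterate_add_apply, add_comm, ← add_assoc]
    exact heq.symm
  classical
  have hspec := Nat.find_spec hex
  have hmin := fun k => Nat.find_min hex (m := k)
  obtain ⟨k, hk⟩ : ∃ k, Nat.find hex = k + 2 := by
    rcases hn : Nat.find hex with _ | _ | k
    · rw [hn] at hspec
      exact absurd hspec hz
    · rw [hn] at hspec
      exact absurd ((comm z e).trans hspec) hze
    · exact ⟨k, rfl⟩
  obtain ⟨p, hp⟩ := hiter k z
  have hw := hmin (k + 1) (by omega)
  rw [hk, Function.iterate_succ_apply', hp] at hspec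
  rw [hp] at hw
  refine absurd (hmax ⟨_, hw⟩) (not_le.2 (Set.ncard_lt_ncard ?_ (Set.toFinite _)))
  rw [Set.ssubset_iff_of_subset]
  · exact ⟨e, (comm _ e).trans hspec, hze⟩
  · intro x hx
    change m (m p z) x = o
    rw [assoc, show m z x = o from hx, h0]

theorem commute_of_mem_commutator_of_eq_mul {G : Type*} [Group G] {A B : Subgroup G}
    (hA : ∀ x ∈ A, ∀ y ∈ A, x * y = y * x) (hB : ∀ x ∈ B, ∀ y ∈ B, x * y = y * x)
    (hAB : ∀ g : G, ∃ a ∈ A, ∃ b ∈ B, g = a * b) {x y : G}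
    (hx : x ∈ commutator G) (hy : y ∈ commutator G) : x * y = y * x := by
  have hconjA : ∀ α ∈ A, ∀ b ∈ B, ∃ b' ∈ B, ∀ a ∈ A, α * ⁅a, b⁆ * α⁻¹ = ⁅a, b'⁆ := by
    intro α hα b hb
    obtain ⟨a₁, ha₁, b₁, hb₁, h⟩ := hAB (α * b * α⁻¹)⁻¹
    refine ⟨b₁⁻¹, inv_mem hb₁, fun a ha => ?_⟩
    have h' : α * b * α⁻¹ = b₁⁻¹ * a₁⁻¹ := by rw [← inv_inv (α * b * α⁻¹), h, mul_inv_rev]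
    have hα' : α * a * α⁻¹ = a := by rw [hA α hα a ha, mul_inv_cancel_right]
    have ha' : a₁⁻¹ * a⁻¹ * a₁ = a⁻¹ := by
      rw [hA _ (inv_mem ha₁) _ (inv_mem ha), inv_mul_cancel_right]
    calc α * ⁅a, b⁆ * α⁻¹ = ⁅α * a * α⁻¹, α * b * α⁻¹⁆ := by simp only [commutatorElement_def]; group
      _ = a * b₁⁻¹ * (a₁⁻¹ * a⁻¹ * a₁) * b₁ := by
        rw [hα', h', commutatorElement_def]; group
      _ = ⁅a, b₁⁻¹⁆ := by rw [ha', commutatorElement_def, inv_inv]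
  have hconjB : ∀ β ∈ B, ∀ a ∈ A, ∃ a' ∈ A, ∀ b ∈ B, β * ⁅a, b⁆ * β⁻¹ = ⁅a', b⁆ := by
    intro β hβ a ha
    obtain ⟨a₁, ha₁, b₁, hb₁, h⟩ := hAB (β * a * β⁻¹)
    refine ⟨a₁, ha₁, fun b hb => ?_⟩
    have hβ' : β * b * β⁻¹ = b := by rw [hB β hβ b hb, mul_inv_cancel_right]
    have hb' : b₁ * b * b₁⁻¹ = b := by rw [hB _ hb₁ _ hb, mul_inv_cancel_right]
    calc β * ⁅a, b⁆ * β⁻¹ = ⁅β * a * β⁻¹, β * b * β⁻¹⁆ := by simp only [commutatorElement_def]; group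
      _ = a₁ * (b₁ * b * b₁⁻¹) * a₁⁻¹ * b⁻¹ := by
        rw [hβ', h, commutatorElement_def]; group
      _ = ⁅a₁, b⁆ := by rw [hb', commutatorElement_def]
  let S : Set G := {g | ∃ a ∈ A, ∃ b ∈ B, ⁅a, b⁆ = g}
  have hS : ∀ s ∈ S, ∀ t ∈ S, s * t = t * s := by
    rintro _ ⟨α, hα, β, hβ, rfl⟩ _ ⟨a, ha, b, hb, rfl⟩
    obtain ⟨b', hb', h₁⟩ := hconjA α⁻¹ (inv_mem hα) b hb
    obtain ⟨a', ha', h₂⟩ := hconjB β⁻¹ (inv_mem hβ) a ha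
    have h₃ : α⁻¹ * (β⁻¹ * ⁅a, b⁆ * β⁻¹⁻¹) * α⁻¹⁻¹ = β⁻¹ * (α⁻¹ * ⁅a, b⁆ * α⁻¹⁻¹) * β⁻¹⁻¹ := by
      rw [h₁ a ha, h₂ b hb, h₁ a' ha', h₂ b' hb']
    generalize ⁅a, b⁆ = c at h₃
    calc ⁅α, β⁆ * c = α * β * (α⁻¹ * (β⁻¹ * c * β⁻¹⁻¹) * α⁻¹⁻¹) * α⁻¹ * β⁻¹ := by
          rw [commutatorElement_def]; group
      _ = c * ⁅α, β⁆ := by rw [h₃, commutatorElement_def]; group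
  have hconj : Group.conjugatesOfSet S ⊆ S := by
    intro g hg
    obtain ⟨_, ⟨a, ha, b, hb, rfl⟩, hg⟩ := Group.mem_conjugatesOfSet_iff.1 hg
    obtain ⟨c, rfl⟩ := isConj_iff.1 hg
    obtain ⟨α, hα, β, hβ, rfl⟩ := hAB c
    obtain ⟨a', ha', h₂⟩ := hconjB β hβ a ha
    obtain ⟨b', hb', h₁⟩ := hconjA α hα b hb
    refine ⟨a', ha', b', hb', ?_⟩
    rw [← h₁ a' ha', ← h₂ b hb, mul_inv_rev]
    simp only [mul_assoc]
  have hle : commutator G ≤ Subgroup.normalClosure S := by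
    have hmem : ∀ a ∈ A, ∀ b ∈ B, ⁅a, b⁆ ∈ Subgroup.normalClosure S := fun a ha b hb =>
      Subgroup.subset_normalClosure ⟨a, ha, b, hb, rfl⟩
    have hN : (Subgroup.normalClosure S).Normal := inferInstance
    refine Subgroup.commutator_le.2 fun g _ h _ => ?_
    obtain ⟨a, ha, b, hb, rfl⟩ := hAB g
    obtain ⟨a', ha', b', hb', rfl⟩ := hAB h
    have e₁ : ⁅a, a'⁆ = 1 := commutatorElement_eq_one_iff_mul_comm.2 (hA a ha a' ha')
    have e₂ : ⁅b, b'⁆ = 1 := commutatorElement_eq_one_iff_mul_comm.2 (hB b hb b' hb')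
    have e : ⁅a * b, a' * b'⁆ = a * (⁅a', b⁆⁻¹ * (a' * ⁅b, b'⁆ * a'⁻¹)) * a⁻¹ *
        (⁅a, a'⁆ * (a' * ⁅a, b'⁆ * a'⁻¹)) := by
      simp only [commutatorElement_def]; group
    rw [e, e₁, e₂, mul_one, mul_inv_cancel, mul_one, one_mul]
    exact mul_mem (hN.conj_mem _ (inv_mem (hmem a' ha' b hb)) _)
      (hN.conj_mem _ (hmem a ha b' hb') _)
  have := Subgroup.isMulCommutative_closure (k := Group.conjugatesOfSet S)
    fun s hs t ht => hS s (hconj hs) t (hconj ht)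
  exact congrArg Subtype.val (this.is_comm.comm ⟨x, hle hx⟩ ⟨y, hle hy⟩)

theorem exists_normal_le_of_eq_mul {G : Type*} [Group G] {N V₁ V₂ : Subgroup G} [Finite N]
    (hNn : N.Normal) (hN : N ≠ ⊥)
    (hV₁ : ∀ x ∈ V₁, ∀ y ∈ V₁, x * y = y * x) (hV₂ : ∀ x ∈ V₂, ∀ y ∈ V₂, x * y = y * x)
    (hV : ∀ g : G, ∃ a ∈ V₁, ∃ b ∈ V₂, g = a * b)
    (hNV : ∀ n ∈ N, ∃ a ∈ N ⊓ V₁, ∃ b ∈ N ⊓ V₂, n = a * b)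
    (hZ : (Subgroup.centralizer N ⊓ (N ⊓ V₁)).Normal) :
    ∃ K : Subgroup G, K.Normal ∧ K ≠ ⊥ ∧ K ≤ N ∧ (K ≤ V₁ ∨ K ≤ V₂) := by
  by_contra hno
  have triv : ∀ K : Subgroup G, K.Normal → K ≤ N → (K ≤ V₁ ∨ K ≤ V₂) → ∀ x ∈ K, x = 1 := by
    intro K hK hKN hKV x hx
    by_contra hx1
    exact hno ⟨K, hK, fun h => hx1 (by rwa [h, Subgroup.mem_bot] at hx), hKN, hKV⟩
  have hZ₁ := triv _ hZ (inf_le_right.trans inf_le_left) (.inl (inf_le_right.trans inf_le_right))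
  have hcent : ∀ x ∈ N, (∀ a ∈ N ⊓ V₁, a * x = x * a) → (∀ b ∈ N ⊓ V₂, b * x = x * b) →
      x ∈ Subgroup.centralizer (N : Set G) := by
    intro x _ ha hb
    refine Subgroup.mem_centralizer_iff.2 fun n hn => ?_
    obtain ⟨a, haV, b, hbV, rfl⟩ := hNV n hn
    rw [mul_assoc, hb b hbV, ← mul_assoc, ha a haV, mul_assoc]
  have hZN : ∀ x ∈ N, x ∈ Subgroup.centralizer (N : Set G) → x = 1 := by
    intro x hxN hx
    refine triv (Subgroup.centralizer N ⊓ N) inferInstance inf_le_right (.inr ?_) x ⟨hx, hxN⟩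
    rintro z ⟨hz, hzN⟩
    obtain ⟨a, ha, b, hb, rfl⟩ := hNV z hzN
    have hbc : b ∈ Subgroup.centralizer (N : Set G) := by
      refine hcent b hb.1 (fun c hc => ?_) fun c hc => hV₂ c hc.2 b hb.2
      have h := Subgroup.mem_centralizer_iff.1 hz c hc.1
      rw [← mul_assoc, hV₁ c hc.2 a ha.2, mul_assoc, mul_assoc] at h
      exact mul_left_cancel h
    have hac := mul_mem hz ((Subgroup.centralizer _).inv_mem hbc)
    rw [mul_inv_cancel_right] at hac
    rw [hZ₁ a ⟨hac, ha⟩, one_mul]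
    exact hb.2
  have hC₁ : ∀ x ∈ N, (∀ a ∈ N ⊓ V₁, a * x = x * a) → x ∈ V₁ := by
    intro x hx h
    obtain ⟨a, ha, b, hb, rfl⟩ := hNV x hx
    rw [hZN b hb.1 (hcent b hb.1 (fun c hc => ?_) fun c hc => hV₂ c hc.2 b hb.2), mul_one]
    · exact ha.2
    · have h := h c hc
      rw [← mul_assoc, hV₁ c hc.2 a ha.2, mul_assoc, mul_assoc] at h
      exact mul_left_cancel h
  have hC₂ : ∀ x ∈ N, (∀ b ∈ N ⊓ V₂, b * x = x * b) → x ∈ V₂ := by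
    intro x hx h
    obtain ⟨a, ha, b, hb, rfl⟩ := hNV x hx
    rw [hZN a ha.1 (hcent a ha.1 (fun c hc => hV₁ c hc.2 a ha.2) fun c hc => ?_), one_mul]
    · exact hb.2
    · have h := h c hc
      rw [mul_assoc a, ← hV₂ c hc.2 b hb.2, ← mul_assoc, ← mul_assoc] at h
      exact mul_right_cancel h
  set E : Subgroup G := N ⊓ commutator G with hE
  have hEn : E.Normal := inferInstance
  have hEc : ∀ x ∈ E, ∀ y ∈ E, x * y = y * x := fun x hx y hy =>
    commute_of_mem_commutator_of_eq_mul hV₁ hV₂ hV hx.2 hy.2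
  have hEmem : ∀ g, ∀ n ∈ N, g * n * g⁻¹ * n⁻¹ ∈ E := fun g n hn =>
    ⟨mul_mem (hNn.conj_mem n hn g) (N.inv_mem hn),
      Subgroup.commutator_mem_commutator (Subgroup.mem_top g) (Subgroup.mem_top n)⟩
  have hW : ∀ V : Subgroup G, (V = V₁ ∨ V = V₂) → (∀ x ∈ V, ∀ y ∈ V, x * y = y * x) →
      (∀ x ∈ N, (∀ a ∈ N ⊓ V, a * x = x * a) → x ∈ V) →
      ∀ x ∈ N ⊓ V, (∀ e ∈ E, e * x = x * e) → x = 1 := by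
    intro V hVV hVc hCV x hx hxE
    refine triv (Subgroup.centralizer E ⊓ (N ⊓ V)) ⟨?_⟩ (inf_le_right.trans inf_le_left)
      (hVV.imp (fun h => (inf_le_right.trans inf_le_right).trans h.le)
        fun h => (inf_le_right.trans inf_le_right).trans h.le) x
      ⟨Subgroup.mem_centralizer_iff.2 hxE, hx⟩
    rintro w ⟨hwE, hwN, hwV⟩ g
    have hgE : g * w * g⁻¹ ∈ Subgroup.centralizer (E : Set G) :=
      (inferInstance : (Subgroup.centralizer (E : Set G)).Normal).conj_mem w hwE g
    have hgN := hNn.conj_mem w hwN g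
    refine ⟨hgE, hgN, hCV _ hgN fun c hc => ?_⟩
    have h₁ := Subgroup.mem_centralizer_iff.1 hwE _ (hEmem g⁻¹ c hc.1)
    have h₂ := hVc c hc.2 w hwV
    have h₃ : g⁻¹ * c * g * w = w * (g⁻¹ * c * g) := by
      calc g⁻¹ * c * g * w = g⁻¹ * c * g⁻¹⁻¹ * c⁻¹ * (c * w) := by group
        _ = g⁻¹ * c * g⁻¹⁻¹ * c⁻¹ * w * c := by rw [h₂]; group
        _ = w * (g⁻¹ * c * g) := by rw [h₁]; group
    calc c * (g * w * g⁻¹) = g * (g⁻¹ * c * g * w) * g⁻¹ := by group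
      _ = g * w * g⁻¹ * c := by rw [h₃]; group
  have hW₁ := hW V₁ (.inl rfl) hV₁ hC₁
  have hW₂ := hW V₂ (.inr rfl) hV₂ hC₂
  have hEnt : Nontrivial E := by
    rw [Subgroup.nontrivial_iff_ne_bot]
    intro hbot
    refine hN ((Subgroup.eq_bot_iff_forall _).2 fun x hx => hZN x hx ?_)
    refine Subgroup.mem_centralizer_iff.2 fun n hn => ?_
    have h := hEmem n x hx
    rw [hbot, Subgroup.mem_bot] at h
    exact commutatorElement_eq_one_iff_mul_comm.1 h
  have : Finite E := Finite.of_injective _ (Subgroup.inclusion_injective (inf_le_left : E ≤ N))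
  choose α hα β hβ hαβ using fun e : E => hNV e e.2.1
  let m : E → E → E := fun x y => ⟨α x * y * (α x)⁻¹ * (y : G)⁻¹, hEmem _ _ y.2.1⟩
  have hm : ∀ x y, (m x y : G) = α x * y * (α x)⁻¹ * (y : G)⁻¹ := fun _ _ => rfl
  have hcomm : ∀ x y, m x y = m y x := by
    intro x y
    have e₁ : (α x)⁻¹ = β x * (x : G)⁻¹ := by rw [hαβ x]; group
    have e₂ : (α y)⁻¹ = β y * (y : G)⁻¹ := by rw [hαβ y]; group
    apply Subtype.ext
    calc (m x y : G) = α x * (α y * β y) * (α x)⁻¹ * (y : G)⁻¹ := by rw [hm, ← hαβ y]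
      _ = α x * α y * (β y * β x) * (y * x : G)⁻¹ := by rw [e₁]; group
      _ = α y * α x * (β x * β y) * (x * y : G)⁻¹ := by
        rw [hV₁ _ (hα x).2 _ (hα y).2, hV₂ _ (hβ x).2 _ (hβ y).2, hEc x x.2 y y.2]
      _ = α y * (α x * β x) * (α y)⁻¹ * (x : G)⁻¹ := by rw [e₂]; group
      _ = m y x := by rw [hm, ← hαβ x]
  have hinv : ∀ x y, m x y⁻¹ = (m x y)⁻¹ := by
    intro x y
    apply Subtype.ext
    have h := hEc _ (inv_mem (hEn.conj_mem _ y.2 (α x))) _ y.2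
    calc (m x y⁻¹ : G) = (α x * y * (α x)⁻¹)⁻¹ * y := by rw [hm]; push_cast; group
      _ = ((m x y)⁻¹ : E) := by rw [h]; push_cast; rw [hm]; group
  have hlc : ∀ x y z, m x (m y z) = m y (m x z) := by
    intro x y z
    have key : ∀ x y : E, (m x (m y z) : G) = (α x * α y) * z * (α x * α y)⁻¹ *
        ((α x * z * (α x)⁻¹) * (α y * z * (α y)⁻¹))⁻¹ * z := by
      intro x y
      have h₁ := hEc _ (mul_mem (inv_mem (hEn.conj_mem _ z.2 (α x))) z.2)
        _ (inv_mem (hEn.conj_mem _ z.2 (α y)))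
      have h₂ := hEc _ z.2 _ (inv_mem (hEn.conj_mem _ z.2 (α y)))
      calc (m x (m y z) : G) = (α x * α y) * z * (α x * α y)⁻¹ *
            ((α x * z * (α x)⁻¹)⁻¹ * (z * (α y * z * (α y)⁻¹)⁻¹)) := by
            rw [hm, hm]; group
        _ = _ := by rw [← mul_assoc _ (z : G), h₁]; group
    apply Subtype.ext
    rw [key, key, hV₁ _ (hα x).2 _ (hα y).2,
      hEc _ (hEn.conj_mem _ z.2 (α x)) _ (hEn.conj_mem _ z.2 (α y))]
  obtain ⟨z, hz, hzm⟩ := exists_ne_forall_eq_of_assoc_comm m 1 hcomm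
    (fun x y z => by rw [hcomm (m x y), hlc, hcomm z]) (fun x => Subtype.ext (by simp [hm])) <| by
      intro p v hpv
      have h : m p⁻¹ v = v⁻¹ := by rw [hcomm, hinv, hcomm, hpv]
      have h' := congrArg Subtype.val h
      rw [hm, Subgroup.coe_inv, mul_eq_right, conj_eq_one_iff] at h'
      exact Subtype.ext h'
  refine hz (Subtype.ext ?_)
  have hαz : α z = 1 := hW₁ _ (hα z) fun e he => by
    have h := congrArg Subtype.val (hzm ⟨e, he⟩)
    exact (commutatorElement_eq_one_iff_mul_comm.1 h).symm
  have hzβ : (z : G) = β z := by rw [hαβ z, hαz, one_mul]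
  exact hW₂ _ (hzβ ▸ hβ z) fun e he => hEc e he z z.2

namespace SkewBrace

variable {B : Type*} [SkewBrace B]

theorem mul_zero_eq_self (a : B) : a * 0 = a := by
  have h := mul_add_dist a 0 0
  rw [add_zero, add_assoc, left_eq_add] at h
  exact (neg_add_eq_zero.1 h).symm

theorem one_eq_zero : (1 : B) = 0 := by
  rw [← mul_zero_eq_self (1 : B), one_mul]

theorem mul_eq_add_lam (a b : B) : a * b = a + lam a b := by
  rw [lam, add_neg_cancel_left]

theorem lam_add (a b c : B) : lam a (b + c) = lam a b + lam a c := by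
  simp only [lam, mul_add_dist, add_assoc]

theorem lam_zero (a : B) : lam a 0 = 0 := by
  rw [lam, mul_zero_eq_self, neg_add_cancel]

theorem lam_neg (a b : B) : lam a (-b) = -lam a b := by
  rw [eq_neg_iff_add_eq_zero, ← lam_add, neg_add_cancel, lam_zero]

theorem lam_mul (a b c : B) : lam (a * b) c = lam a (lam b c) := by
  rw [lam.eq_def b c, lam_add, lam_neg]
  simp only [lam, neg_add_rev, neg_neg, mul_assoc, add_assoc, add_neg_cancel_left]

theorem lam_one (a : B) : lam 1 a = a := by
  rw [lam, one_mul, one_eq_zero, neg_zero, zero_add]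

theorem lam_inv_lam (a b : B) : lam a⁻¹ (lam a b) = b := by
  rw [← lam_mul, inv_mul_cancel, lam_one]

theorem lam_lam_inv (a b : B) : lam a (lam a⁻¹ b) = b := by
  rw [← lam_mul, mul_inv_cancel, lam_one]

theorem inv_eq_neg_lam (a : B) : a⁻¹ = -lam a⁻¹ a := by
  rw [lam, inv_mul_cancel, one_eq_zero, add_zero, neg_neg]

theorem star_eq_lam_add_neg (a b : B) : star a b = lam a b + -b := rfl

theorem IsTrivialSubbrace.lam_eq {S : Set B} (hS : IsTrivialSubbrace S) {a b : B} (ha : a ∈ S)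
    (hb : b ∈ S) : lam a b = b := by
  rw [lam, hS.2 a ha b hb, neg_add_cancel_left]

theorem IsLeftIdeal.lam_mem {S : Set B} (hS : IsLeftIdeal S) (b : B) {a : B} (ha : a ∈ S) :
    lam b a ∈ S := by
  have h := hS.1.1.2.1 _ (hS.2 b a ha) a ha
  rwa [star_eq_lam_add_neg, neg_add_cancel_right] at h

/-- The lambda map as an action of `(B,·)` on `(B,+)` by automorphisms. -/
def lamHom (B : Type*) [SkewBrace B] : B →* MulAut (Multiplicative B) where
  toFun b :=
    { toFun := fun x => .ofAdd (lam b x.toAdd)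
      invFun := fun x => .ofAdd (lam b⁻¹ x.toAdd)
      left_inv := fun x => lam_inv_lam b x.toAdd
      right_inv := fun x => lam_lam_inv b x.toAdd
      map_mul' := fun x y => lam_add b x.toAdd y.toAdd }
  map_one' := MulEquiv.ext fun x => lam_one x.toAdd
  map_mul' a b := MulEquiv.ext fun x => lam_mul a b x.toAdd

/-- The elements of `(B,+) ⋊ (B,·)` with both components in a trivial subbrace. -/
def IsTrivialSubbrace.subgroup {S : Set B} (hS : IsTrivialSubbrace S) :
    Subgroup (Multiplicative B ⋊[lamHom B] B) where
  carrier := {g | g.left.toAdd ∈ S ∧ g.right ∈ S}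
  one_mem' := ⟨hS.1.1.1, hS.1.2.1⟩
  mul_mem' := by
    rintro g h ⟨hg, hg'⟩ ⟨hh, hh'⟩
    refine ⟨?_, hS.1.2.2.1 _ hg' _ hh'⟩
    change g.left.toAdd + lam g.right h.left.toAdd ∈ S
    rw [hS.lam_eq hg' hh]
    exact hS.1.1.2.1 _ hg _ hh
  inv_mem' := by
    rintro g ⟨hg, hg'⟩
    have hi := hS.1.2.2.2 _ hg'
    refine ⟨?_, hi⟩
    change lam g.right⁻¹ (-g.left.toAdd) ∈ S
    rw [hS.lam_eq hi (hS.1.1.2.2 _ hg)]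
    exact hS.1.1.2.2 _ hg

theorem IsAbelianSubbrace.commute_of_mem_subgroup {S : Set B} (hS : IsAbelianSubbrace S) :
    ∀ x ∈ hS.1.subgroup, ∀ y ∈ hS.1.subgroup, x * y = y * x := by
  rintro x ⟨hx, hx'⟩ y ⟨hy, hy'⟩
  apply SemidirectProduct.ext
  · change x.left.toAdd + lam x.right y.left.toAdd = y.left.toAdd + lam y.right x.left.toAdd
    rw [hS.1.lam_eq hx' hy, hS.1.lam_eq hy' hx, hS.2 _ hx _ hy]
  · change x.right * y.right = y.right * x.right
    rw [hS.1.2 _ hx' _ hy', hS.1.2 _ hy' _ hx', hS.2 _ hx' _ hy']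

/-- A normal subgroup of `(B,+) ⋊ (B,·)` meets `(B,+)` in a strong left ideal. -/
theorem isStrongLeftIdeal_of_normal {K : Subgroup (Multiplicative B ⋊[lamHom B] B)}
    (hK : K.Normal) :
    IsStrongLeftIdeal {x : B | SemidirectProduct.inl (.ofAdd x) ∈ K} := by
  set S := {x : B | SemidirectProduct.inl (.ofAdd x) ∈ K}
  have hzero : (0 : B) ∈ S := K.one_mem
  have hadd : ∀ a ∈ S, ∀ b ∈ S, a + b ∈ S := by
    intro a ha b hb
    have h := K.mul_mem ha hb
    rwa [← map_mul] at h
  have hneg : ∀ a ∈ S, -a ∈ S := by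
    intro a ha
    have h := K.inv_mem ha
    rwa [← map_inv] at h
  have hlam : ∀ b, ∀ a ∈ S, lam b a ∈ S := by
    intro b a ha
    have h := hK.conj_mem _ ha (SemidirectProduct.inr b)
    rwa [← map_inv, ← SemidirectProduct.inl_aut] at h
  refine ⟨⟨⟨⟨hzero, hadd, hneg⟩, ?_, fun a ha b hb => ?_, fun a ha => ?_⟩, fun b a ha => ?_⟩,
    fun b a ha => ?_⟩
  · rwa [one_eq_zero]
  · rw [mul_eq_add_lam]
    exact hadd _ ha _ (hlam _ _ hb)
  · rw [inv_eq_neg_lam]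
    exact hneg _ (hlam _ _ ha)
  · exact hadd _ (hlam b a ha) _ (hneg _ ha)
  · have h := hK.conj_mem _ ha (SemidirectProduct.inl (.ofAdd b))
    rwa [← map_inv, ← map_mul, ← map_mul] at h

end SkewBrace

open SkewBrace in
/-- If a finite non-zero skew brace `B = A₁ + A₂` is the sum of two abelian
subbraces with `A₁` a left ideal, then there exists a non-zero strong left
ideal of `B` contained in `A₁` or in `A₂`. -/
theorem exists_strongLeftIdeal {B : Type*} [SkewBrace B] [Finite B] [Nontrivial B]
    (A₁ A₂ : Set B)
    (h₁ : IsAbelianSubbrace A₁) (h₂ : IsAbelianSubbrace A₂)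
    (hsum : ∀ x : B, ∃ a ∈ A₁, ∃ b ∈ A₂, x = a + b)
    (hleft : IsLeftIdeal A₁) :
    ∃ S : Set B, IsStrongLeftIdeal S ∧ (∃ a ∈ S, a ≠ 0) ∧ (S ⊆ A₁ ∨ S ⊆ A₂) := by
  let V₁ := h₁.1.subgroup
  let V₂ := h₂.1.subgroup
  let N : Subgroup (Multiplicative B ⋊[lamHom B] B) :=
    (SemidirectProduct.rightHom (φ := lamHom B)).ker
  have hinl : ∀ g ∈ N, g = SemidirectProduct.inl g.left := fun g hg =>
    SemidirectProduct.ext rfl hg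
  have hfin : Finite (Multiplicative B ⋊[lamHom B] B) :=
    Finite.of_equiv _ SemidirectProduct.equivProd.symm
  have hne : N ≠ ⊥ := by
    obtain ⟨x, hx⟩ := exists_ne (0 : B)
    intro h
    have hxN : SemidirectProduct.inl (.ofAdd x) ∈ N := rfl
    rw [h, Subgroup.mem_bot] at hxN
    exact hx (congrArg (fun g => g.left.toAdd) hxN)
  have hmul : ∀ y : B, ∃ a ∈ A₁, ∃ b ∈ A₂, y = a * b := by
    intro y
    obtain ⟨a, ha, b, hb, h⟩ := hsum (-y⁻¹)
    refine ⟨(lam (-b)⁻¹ (-a))⁻¹, h₁.1.1.2.2.2 _ (hleft.lam_mem _ (h₁.1.1.1.2.2 _ ha)),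
      (-b)⁻¹, h₂.1.1.2.2.2 _ (h₂.1.1.1.2.2 _ hb), ?_⟩
    rw [← mul_inv_rev, mul_eq_add_lam, lam_lam_inv, ← neg_add_rev, ← h, neg_neg, inv_inv]
  have hV : ∀ g, ∃ a ∈ V₁, ∃ b ∈ V₂, g = a * b := by
    intro g
    obtain ⟨a, ha, b, hb, hg⟩ := hmul g.right
    obtain ⟨c, hc, d, hd, hx⟩ := hsum (lam a⁻¹ g.left.toAdd)
    refine ⟨⟨.ofAdd c, a⟩, ⟨hc, ha⟩, ⟨.ofAdd d, b⟩, ⟨hd, hb⟩, SemidirectProduct.ext ?_ hg⟩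
    change g.left.toAdd = c + lam a d
    rw [← lam_lam_inv a g.left.toAdd, hx, lam_add, h₁.1.lam_eq ha hc]
  have hNV : ∀ n ∈ N, ∃ a ∈ N ⊓ V₁, ∃ b ∈ N ⊓ V₂, n = a * b := by
    intro n hn
    obtain ⟨a, ha, b, hb, h⟩ := hsum n.left.toAdd
    refine ⟨SemidirectProduct.inl (.ofAdd a), ⟨rfl, ha, h₁.1.1.2.1⟩,
      SemidirectProduct.inl (.ofAdd b), ⟨rfl, hb, h₂.1.1.2.1⟩, ?_⟩
    rw [← map_mul, hinl n hn]
    exact congrArg SemidirectProduct.inl h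
  have hZ : (Subgroup.centralizer N ⊓ (N ⊓ V₁)).Normal := by
    refine ⟨fun n hn g => ?_⟩
    have hC : (Subgroup.centralizer (N : Set (Multiplicative B ⋊[lamHom B] B))).Normal :=
      inferInstance
    have hN : N.Normal := inferInstance
    refine ⟨hC.conj_mem _ hn.1 g, hN.conj_mem _ hn.2.1 g, ?_⟩
    have h := Subgroup.mem_centralizer_iff.1 (hC.conj_mem _ hn.1 (SemidirectProduct.inr g.right))
      (SemidirectProduct.inl g.left) rfl
    have hg : g * n * g⁻¹ = SemidirectProduct.inl (lamHom B g.right n.left) := by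
      rw [SemidirectProduct.inl_aut, ← hinl n hn.2.1, map_inv]
      conv_lhs => rw [← SemidirectProduct.inl_left_mul_inr_right g]
      rw [mul_inv_rev, ← mul_assoc, mul_inv_eq_iff_eq_mul, ← h]
      group
    rw [hg]
    exact ⟨hleft.lam_mem _ hn.2.2.1, h₁.1.1.2.1⟩
  obtain ⟨K, hK, hK1, hKN, hKV⟩ := exists_normal_le_of_eq_mul (N := N) inferInstance hne
    h₁.commute_of_mem_subgroup h₂.commute_of_mem_subgroup hV hNV hZ
  refine ⟨_, isStrongLeftIdeal_of_normal hK, ?_,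
    hKV.imp (fun h x hx => (h hx).1) fun h x hx => (h hx).1⟩
  obtain ⟨k, hk, hk1⟩ := K.bot_or_exists_ne_one.resolve_left hK1
  have hkl := hinl k (hKN hk)
  refine ⟨k.left.toAdd, ?_, fun h => hk1 ?_⟩
  · rw [hkl] at hk
    exact hk
  · rw [hkl, show k.left = 1 from h, map_one]
end
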